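/- (De Giorgi–Nash interior Hölder estimate) Let n ≥ 1 and λ ∈ (0,1]. There exist α ∈ (0,1) and C > 0 depending only on n and λ such that: for every measurable coefficient field a on B₁ ⊂ ℝⁿ that is uniformly elliptic with constant λ, and every bounded v ∈ C¹(B₁) that is a weak solution of div(a∇v) = 0 in B₁, one has |v(x) − v(y)| ≤ C · (sup_{B₁} |v|) · |x − y|^α for all x, y ∈ B_{1/2}. -/

import Mathlib

open MeasureTheory Metric

noncomputable section

/-- A coefficient field `a` on `U ⊆ ℝⁿ` is uniformly elliptic with constant `lam ∈ (0,1]`. -/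
def UniformlyElliptic {n : ℕ} (lam : ℝ) (U : Set (EuclideanSpace ℝ (Fin n)))
    (a : EuclideanSpace ℝ (Fin n) → Matrix (Fin n) (Fin n) ℝ) : Prop :=
  ∀ x ∈ U, (a x).IsSymm ∧
    ∀ ξ : EuclideanSpace ℝ (Fin n),
      lam * ‖ξ‖ ^ 2 ≤ ∑ i, ∑ j, ξ i * a x i j * ξ j ∧
        ∑ i, ∑ j, ξ i * a x i j * ξ j ≤ lam⁻¹ * ‖ξ‖ ^ 2

/-- `v` is a weak solution of `div(a ∇v) = 0` in `U`. -/
def IsWeakSolution {n : ℕ} (U : Set (EuclideanSpace ℝ (Fin n)))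
    (a : EuclideanSpace ℝ (Fin n) → Matrix (Fin n) (Fin n) ℝ)
    (v : EuclideanSpace ℝ (Fin n) → ℝ) : Prop :=
  ∀ φ : EuclideanSpace ℝ (Fin n) → ℝ,
    ContDiff ℝ 1 φ → HasCompactSupport φ → tsupport φ ⊆ U →
      ∫ x in U, ∑ i, ∑ j, gradient φ x i * a x i j * gradient v x j = 0

section Sobolev

/-- On the line, the values of a compactly supported `C¹` function are bounded by the total mass of
its derivative. -/
lemma enorm_le_lintegral_enorm_fderiv_fin_one {u : EuclideanSpace ℝ (Fin 1) → ℝ}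
    (hu : ContDiff ℝ 1 u) (h2u : HasCompactSupport u) (x : EuclideanSpace ℝ (Fin 1)) :
    ‖u x‖ₑ ≤ ∫⁻ y, ‖fderiv ℝ u y‖ₑ := by
  let L : ℝ ≃ₗᵢ[ℝ] EuclideanSpace ℝ (Fin 1) := (OrthonormalBasis.singleton (Fin 1) ℝ).repr
  have hmp : MeasurePreserving L := OrthonormalBasis.measurePreserving_repr _
  have hcd : ContDiff ℝ 1 (u ∘ L) := hu.comp L.contDiff
  have hcs : HasCompactSupport (u ∘ L) := h2u.comp_homeomorph L.toHomeomorph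
  have h1 := HasCompactSupport.enorm_le_lintegral_Ici_deriv hcd hcs (L.symm x)
  have h2 : ∀ t, ‖deriv (u ∘ L) t‖ₑ ≤ ‖fderiv ℝ u (L t)‖ₑ := by
    intro t
    have hd : HasDerivAt (u ∘ L) (fderiv ℝ u (L t) (L 1)) t := by
      have e1 : HasFDerivAt u (fderiv ℝ u (L t)) (L t) :=
        (hu.differentiable one_ne_zero _).hasFDerivAt
      have e2 : HasDerivAt L (L 1) t := by
        have := (L.toContinuousLinearEquiv : ℝ →L[ℝ] EuclideanSpace ℝ (Fin 1)).hasFDerivAt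
          (x := t) |>.hasDerivAt
        simpa using this
      exact e1.comp_hasDerivAt t e2
    rw [hd.deriv]
    refine enorm_le_iff_norm_le.2 ((fderiv ℝ u (L t)).le_opNorm _ |>.trans ?_)
    simp
  calc ‖u x‖ₑ = ‖(u ∘ L) (L.symm x)‖ₑ := by simp
    _ ≤ ∫⁻ y in Set.Iic (L.symm x), ‖deriv (u ∘ L) y‖ₑ := h1
    _ ≤ ∫⁻ y, ‖deriv (u ∘ L) y‖ₑ := setLIntegral_le_lintegral _ _
    _ ≤ ∫⁻ y, ‖fderiv ℝ u (L y)‖ₑ := lintegral_mono h2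
    _ = ∫⁻ y, ‖fderiv ℝ u y‖ₑ :=
      hmp.lintegral_comp (f := fun y => ‖fderiv ℝ u y‖ₑ) (measurable_fderiv ℝ u).enorm

/-- An `L¹` Sobolev inequality in terms of the measure of a set carrying the function, valid in
every dimension `n ≥ 1`. -/
lemma lintegral_enorm_le_measure_rpow_mul_lintegral_fderiv {n : ℕ} (hn : 1 ≤ n) :
    ∃ C : NNReal, ∀ u : EuclideanSpace ℝ (Fin n) → ℝ, ContDiff ℝ 1 u → HasCompactSupport u →
      ∀ S : Set (EuclideanSpace ℝ (Fin n)), MeasurableSet S → (∀ x ∉ S, u x = 0) →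
        ∫⁻ x, ‖u x‖ₑ ≤ volume S ^ (1 / n : ℝ) * (C * ∫⁻ x, ‖fderiv ℝ u x‖ₑ) := by
  have hS (u : EuclideanSpace ℝ (Fin n) → ℝ) (S : Set (EuclideanSpace ℝ (Fin n)))
      (hS : ∀ x ∉ S, u x = 0) : ∫⁻ x, ‖u x‖ₑ = ∫⁻ x in S, ‖u x‖ₑ := by
    refine (setLIntegral_eq_of_support_subset ?_).symm
    intro x hx
    by_contra h
    simp [hS x h] at hx
  obtain rfl | hn2 := hn.eq_or_lt
  · refine ⟨1, fun u hu h2u S hSm hS0 => ?_⟩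
    rw [hS u S hS0]
    calc ∫⁻ x in S, ‖u x‖ₑ ≤ ∫⁻ x in S, ∫⁻ y, ‖fderiv ℝ u y‖ₑ :=
          lintegral_mono fun x => enorm_le_lintegral_enorm_fderiv_fin_one hu h2u x
      _ = _ := by simp [mul_comm]
  · have hn' : (1 : ℝ) < n := by exact_mod_cast hn2
    let p : NNReal := NNReal.conjExponent n
    have hp : NNReal.HolderConjugate (n : NNReal) p :=
      NNReal.HolderConjugate.conjExponent (by exact_mod_cast hn2)
    have hp' : NNReal.HolderConjugate
        (Module.finrank ℝ (EuclideanSpace ℝ (Fin n)) : NNReal) p := by simpa using hp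
    refine ⟨eLpNormLESNormFDerivOneConst (volume : Measure (EuclideanSpace ℝ (Fin n))) p,
      fun u hu h2u S hSm hS0 => ?_⟩
    have h1 := eLpNorm_le_eLpNorm_fderiv_one volume hu h2u hp'
    have hpe : (1 : ℝ) - 1 / p = 1 / n := by
      have := hp.coe.inv_add_inv_eq_one
      simp only [one_div] at this ⊢
      push_cast at this
      linarith
    have h2 := eLpNorm_le_eLpNorm_mul_rpow_measure_univ (p := 1) (q := p)
      (μ := volume.restrict S) (f := u) (by exact_mod_cast hp.symm.lt.le)
      hu.continuous.aestronglyMeasurable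
    rw [eLpNorm_one_eq_lintegral_enorm, ← hS u S hS0] at h2
    simp only [ENNReal.toReal_one, div_one, ENNReal.coe_toReal, Measure.restrict_apply_univ,
      hpe] at h2
    rw [eLpNorm_one_eq_lintegral_enorm] at h1
    calc _ ≤ _ := h2
      _ ≤ eLpNorm u p volume * volume S ^ (1 / n : ℝ) := by
        gcongr
        exact Measure.restrict_le_self
      _ ≤ _ := by rw [mul_comm]; gcongr

lemma norm_gradient {n : ℕ} (u : EuclideanSpace ℝ (Fin n) → ℝ) (x : EuclideanSpace ℝ (Fin n)) :
    ‖gradient u x‖ = ‖fderiv ℝ u x‖ := by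
  simp [gradient]

lemma continuous_gradient {n : ℕ} {u : EuclideanSpace ℝ (Fin n) → ℝ} (hu : ContDiff ℝ 1 u) :
    Continuous (gradient u) :=
  (LinearIsometryEquiv.continuous _).comp (hu.continuous_fderiv one_ne_zero)

lemma gradient_eq_zero_of_notMem_tsupport {n : ℕ} {u : EuclideanSpace ℝ (Fin n) → ℝ}
    {x : EuclideanSpace ℝ (Fin n)} (hx : x ∉ tsupport u) : gradient u x = 0 := by
  simp [gradient, fderiv_of_notMem_tsupport ℝ hx]

/-- A Faber-Krahn inequality. -/
lemma integral_sq_le_measure_rpow_mul_integral_gradient_sq {n : ℕ} (hn : 1 ≤ n) :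
    ∃ C > (0 : ℝ), ∀ w : EuclideanSpace ℝ (Fin n) → ℝ, ContDiff ℝ 1 w → HasCompactSupport w →
      ∀ S : Set (EuclideanSpace ℝ (Fin n)), MeasurableSet S → volume S ≠ ⊤ →
        (∀ x ∉ S, w x = 0) →
        ∫ x, w x ^ 2 ≤ C * volume.real S ^ (2 / n : ℝ) * ∫ x, ‖gradient w x‖ ^ 2 := by
  obtain ⟨C, hC⟩ := lintegral_enorm_le_measure_rpow_mul_lintegral_fderiv hn
  refine ⟨4 * (C : ℝ) ^ 2 + 1, by positivity, fun w hw h2w S hSm hSf hS0 => ?_⟩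
  have hcw := hw.continuous
  have hcg := continuous_gradient hw
  have hu : ContDiff ℝ 1 (fun x => w x ^ 2) := hw.pow 2
  have h2u : HasCompactSupport (fun x => w x ^ 2) := h2w.comp_left (g := fun t => t ^ 2) (by simp)
  have hfd : ∀ x, ‖fderiv ℝ (fun x => w x ^ 2) x‖ = 2 * (|w x| * ‖gradient w x‖) := by
    intro x
    have := ((hw.differentiable one_ne_zero x).hasFDerivAt.pow 2).fderiv
    rw [this, norm_gradient, norm_smul]
    simp
    ring
  have key := hC _ hu h2u S hSm (fun x hx => by simp [hS0 x hx])
  have i1 : Integrable (fun x => w x ^ 2) := hu.continuous.integrable_of_hasCompactSupport h2u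
  have i2 : Integrable (fderiv ℝ (fun x => w x ^ 2)) :=
    (hu.continuous_fderiv one_ne_zero).integrable_of_hasCompactSupport (h2u.fderiv ℝ)
  have i3 : Integrable (fun x => ‖gradient w x‖ ^ 2) :=
    (hcg.norm.pow 2).integrable_of_hasCompactSupport
      (HasCompactSupport.intro h2w fun x hx => by simp [gradient_eq_zero_of_notMem_tsupport hx])
  rw [← ofReal_integral_norm_eq_lintegral_enorm i1,
    ← ofReal_integral_norm_eq_lintegral_enorm i2] at key
  set s : ℝ := volume.real S ^ (1 / n : ℝ) with hs
  have hs0 : 0 ≤ s := by positivity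
  have hvs : volume S ^ (1 / n : ℝ) = ENNReal.ofReal s := by
    rw [hs, ← ENNReal.ofReal_rpow_of_nonneg measureReal_nonneg (by positivity),
      ofReal_measureReal hSf]
  rw [hvs, ← ENNReal.ofReal_coe_nnreal, ← ENNReal.ofReal_mul (by positivity),
    ← ENNReal.ofReal_mul hs0, ENNReal.ofReal_le_ofReal_iff (by positivity)] at key
  have hs2 : volume.real S ^ (2 / n : ℝ) = s ^ 2 := by
    rw [hs, ← Real.rpow_natCast, ← Real.rpow_mul measureReal_nonneg]
    congr 1
    push_cast
    ring
  rw [hs2]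
  have e1 : ∫ x, ‖w x ^ 2‖ = ∫ x, w x ^ 2 := by simp
  rw [e1] at key
  have h3 : ∫ x, s * (C * ‖fderiv ℝ (fun x => w x ^ 2) x‖) ≤
      ∫ x, (1 / 2 * w x ^ 2 + 2 * C ^ 2 * s ^ 2 * ‖gradient w x‖ ^ 2) := by
    refine integral_mono ((i2.norm.const_mul _).const_mul _)
      ((i1.const_mul _).add (i3.const_mul _)) fun x => ?_
    simp only [hfd]
    nlinarith [sq_nonneg (|w x| - 2 * C * s * ‖gradient w x‖), sq_abs (w x)]
  rw [integral_add (i1.const_mul _) (i3.const_mul _)] at h3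
  simp only [integral_const_mul] at h3 key
  have h4 : 0 ≤ s ^ 2 * ∫ x, ‖gradient w x‖ ^ 2 := by positivity
  nlinarith

end Sobolev

section WeakSolutions

variable {n : ℕ}

/-- The bilinear form `ξ · A η`. -/
def coeffForm (A : Matrix (Fin n) (Fin n) ℝ) (ξ η : EuclideanSpace ℝ (Fin n)) : ℝ :=
  ∑ i, ∑ j, ξ i * A i j * η j

lemma coeffForm_add_left (A : Matrix (Fin n) (Fin n) ℝ) (ξ η ζ : EuclideanSpace ℝ (Fin n)) :
    coeffForm A (ξ + η) ζ = coeffForm A ξ ζ + coeffForm A η ζ := by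
  simp [coeffForm, add_mul, Finset.sum_add_distrib]

lemma coeffForm_add_right (A : Matrix (Fin n) (Fin n) ℝ) (ξ η ζ : EuclideanSpace ℝ (Fin n)) :
    coeffForm A ζ (ξ + η) = coeffForm A ζ ξ + coeffForm A ζ η := by
  simp [coeffForm, mul_add, Finset.sum_add_distrib]

lemma coeffForm_smul_left (A : Matrix (Fin n) (Fin n) ℝ) (c : ℝ)
    (ξ ζ : EuclideanSpace ℝ (Fin n)) : coeffForm A (c • ξ) ζ = c * coeffForm A ξ ζ := by
  simp [coeffForm, Finset.mul_sum, mul_assoc]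

lemma coeffForm_smul_right (A : Matrix (Fin n) (Fin n) ℝ) (c : ℝ)
    (ξ ζ : EuclideanSpace ℝ (Fin n)) : coeffForm A ζ (c • ξ) = c * coeffForm A ζ ξ := by
  simp only [coeffForm, Finset.mul_sum]
  refine Finset.sum_congr rfl fun i _ => Finset.sum_congr rfl fun j _ => ?_
  simp
  ring

lemma coeffForm_comm {A : Matrix (Fin n) (Fin n) ℝ} (hA : A.IsSymm)
    (ξ ζ : EuclideanSpace ℝ (Fin n)) : coeffForm A ξ ζ = coeffForm A ζ ξ := by
  simp only [coeffForm]
  rw [Finset.sum_comm]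
  refine Finset.sum_congr rfl fun i _ => Finset.sum_congr rfl fun j _ => ?_
  rw [hA.apply i j]
  ring

lemma coeffForm_combination {A : Matrix (Fin n) (Fin n) ℝ} (hA : A.IsSymm) (s t : ℝ)
    (ξ ζ : EuclideanSpace ℝ (Fin n)) :
    coeffForm A (s • ξ + t • ζ) (s • ξ + t • ζ) =
      s ^ 2 * coeffForm A ξ ξ + 2 * s * t * coeffForm A ζ ξ + t ^ 2 * coeffForm A ζ ζ := by
  simp only [coeffForm_add_left, coeffForm_add_right, coeffForm_smul_left, coeffForm_smul_right,
    coeffForm_comm hA ξ ζ]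
  ring

/-- A globally `C¹` function solving a uniformly elliptic equation in the unit ball. -/
structure IsEllipticSolution (lam : ℝ)
    (a : EuclideanSpace ℝ (Fin n) → Matrix (Fin n) (Fin n) ℝ)
    (v : EuclideanSpace ℝ (Fin n) → ℝ) : Prop where
  measurable : ∀ i j, Measurable fun x => a x i j
  elliptic : UniformlyElliptic lam (ball 0 1) a
  contDiff : ContDiff ℝ 1 v
  weak : IsWeakSolution (ball 0 1) a v

variable {lam : ℝ} {a : EuclideanSpace ℝ (Fin n) → Matrix (Fin n) (Fin n) ℝ}
  {v : EuclideanSpace ℝ (Fin n) → ℝ} {U : Set (EuclideanSpace ℝ (Fin n))}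

lemma isWeakSolution_iff : IsWeakSolution U a v ↔
    ∀ φ : EuclideanSpace ℝ (Fin n) → ℝ, ContDiff ℝ 1 φ → HasCompactSupport φ → tsupport φ ⊆ U →
      ∫ x, coeffForm (a x) (gradient φ x) (gradient v x) = 0 := by
  refine forall₄_congr fun φ _ _ hφ => ?_
  rw [← setIntegral_eq_integral_of_forall_compl_eq_zero (s := U)
    (f := fun x => coeffForm (a x) (gradient φ x) (gradient v x))]
  · rfl
  · intro x hx
    simp [coeffForm, gradient_eq_zero_of_notMem_tsupport fun h => hx (hφ h)]

lemma IsWeakSolution.mono {U' : Set (EuclideanSpace ℝ (Fin n))} (h : IsWeakSolution U a v)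
    (hU : U' ⊆ U) : IsWeakSolution U' a v := by
  rw [isWeakSolution_iff] at h ⊢
  exact fun φ h1 h2 h3 => h φ h1 h2 (h3.trans hU)

lemma IsWeakSolution.congr {w : EuclideanSpace ℝ (Fin n) → ℝ} (h : IsWeakSolution U a v)
    (hU : IsOpen U) (hvw : Set.EqOn v w U) : IsWeakSolution U a w := by
  intro φ h1 h2 h3
  rw [← h φ h1 h2 h3]
  refine setIntegral_congr_fun hU.measurableSet fun x hx => ?_
  have : fderiv ℝ w x = fderiv ℝ v x :=
    (Filter.eventuallyEq_of_mem (hU.mem_nhds hx) hvw).fderiv_eq.symm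
  simp [gradient, this]

lemma IsEllipticSolution.affine (h : IsEllipticSolution lam a v) (c d : ℝ) :
    IsEllipticSolution lam a (fun x => c * v x + d) := by
  refine ⟨h.measurable, h.elliptic, (contDiff_const.mul h.contDiff).add contDiff_const, ?_⟩
  have hw := isWeakSolution_iff.1 h.weak
  refine isWeakSolution_iff.2 fun φ h1 h2 h3 => ?_
  have hg : ∀ x, gradient (fun x => c * v x + d) x = c • gradient v x := by
    intro x
    have : HasFDerivAt (fun x => c * v x + d) (c • fderiv ℝ v x) x :=
      ((h.contDiff.differentiable one_ne_zero x).hasFDerivAt.const_mul c).add_const d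
    simp [gradient, this.fderiv]
  simp only [hg, coeffForm_smul_right]
  rw [integral_const_mul, hw φ h1 h2 h3, mul_zero]

lemma gradient_comp_affine (u : EuclideanSpace ℝ (Fin n) → ℝ) (x₀ : EuclideanSpace ℝ (Fin n))
    (r : ℝ) (x : EuclideanSpace ℝ (Fin n)) :
    gradient (fun x => u (x₀ + r • x)) x = r • gradient u (x₀ + r • x) := by
  have h1 := fderiv_comp_smul (𝕜 := ℝ) (f := fun y => u (x₀ + y)) (x := x) r
  have h2 := fderiv_comp_add_left (𝕜 := ℝ) (f := u) (x := r • x) x₀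
  simp only [gradient, h1, h2, map_smulₛₗ]
  simp

lemma IsWeakSolution.comp_affine {x₀ : EuclideanSpace ℝ (Fin n)} {r : ℝ} (hr : 0 < r)
    (h : IsWeakSolution (ball x₀ r) a v) :
    IsWeakSolution (ball 0 1) (fun x => a (x₀ + r • x)) (fun x => v (x₀ + r • x)) := by
  rw [isWeakSolution_iff] at h ⊢
  intro φ h1 h2 h3
  let e : EuclideanSpace ℝ (Fin n) ≃ₜ EuclideanSpace ℝ (Fin n) :=
    (Homeomorph.addLeft (-x₀)).trans (Homeomorph.smulOfNeZero r⁻¹ (inv_ne_zero hr.ne'))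
  have he : ∀ z, e z = -(r⁻¹ • x₀) + r⁻¹ • z := fun z => by simp [e]
  have hez : ∀ x, -(r⁻¹ • x₀) + r⁻¹ • (x₀ + r • x) = x := fun x => by
    simp [smul_add, smul_smul, hr.ne']
  have hψ := h (fun z => φ (-(r⁻¹ • x₀) + r⁻¹ • z)) (h1.comp (by fun_prop)) ?_ ?_
  · rw [← integral_add_left_eq_self _ x₀] at hψ
    have hs := Measure.integral_comp_smul (volume : Measure (EuclideanSpace ℝ (Fin n)))
      (fun x => coeffForm (a (x₀ + x)) (gradient (fun z => φ (-(r⁻¹ • x₀) + r⁻¹ • z)) (x₀ + x))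
        (gradient v (x₀ + x))) r
    rw [hψ, smul_zero] at hs
    simp only [gradient_comp_affine, coeffForm_smul_right, coeffForm_smul_left, hez] at hs ⊢
    rw [integral_const_mul] at hs ⊢
    simpa [hr.ne'] using hs
  · have := h2.comp_homeomorph e
    simpa only [Function.comp_def, he] using this
  · have := tsupport_comp_eq_preimage φ e
    simp only [Function.comp_def, he] at this
    rw [this]
    intro z hz
    have hz' := h3 hz
    rw [mem_ball_zero_iff] at hz'
    have : -(r⁻¹ • x₀) + r⁻¹ • z = r⁻¹ • (z - x₀) := by rw [smul_sub]; abel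
    rw [he, this, norm_smul, norm_inv, Real.norm_of_nonneg hr.le, inv_mul_lt_one₀ hr] at hz'
    rwa [mem_ball_iff_norm]

lemma IsEllipticSolution.of_affine {x₀ : EuclideanSpace ℝ (Fin n)} {r : ℝ} (hr : 0 < r)
    (ham : ∀ i j, Measurable fun x => a x i j) (hae : UniformlyElliptic lam (ball x₀ r) a)
    (hv : ContDiff ℝ 1 v) (h : IsWeakSolution (ball x₀ r) a v) :
    IsEllipticSolution lam (fun x => a (x₀ + r • x)) (fun x => v (x₀ + r • x)) := by
  refine ⟨fun i j => (ham i j).comp (by fun_prop), fun x hx => hae _ ?_, hv.comp (by fun_prop),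
    h.comp_affine hr⟩
  rw [mem_ball_zero_iff] at hx
  rw [mem_ball_iff_norm, add_sub_cancel_left, norm_smul, Real.norm_of_nonneg hr.le]
  nlinarith

lemma IsEllipticSolution.scale (h : IsEllipticSolution lam a v) {r : ℝ} (hr : 0 < r)
    (hr1 : r ≤ 1) :
    IsEllipticSolution lam (fun x => a (r • x)) (fun x => v (r • x)) := by
  have hsub : ball (0 : EuclideanSpace ℝ (Fin n)) r ⊆ ball 0 1 := ball_subset_ball hr1
  simpa using IsEllipticSolution.of_affine (x₀ := 0) hr h.measurable
    (fun x hx => h.elliptic x (hsub hx)) h.contDiff (h.weak.mono hsub)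

lemma UniformlyElliptic.abs_coeffForm_le (h : UniformlyElliptic lam U a) (hlam : 0 < lam)
    {x : EuclideanSpace ℝ (Fin n)} (hx : x ∈ U) (ξ ζ : EuclideanSpace ℝ (Fin n)) :
    |coeffForm (a x) ζ ξ| ≤ lam⁻¹ * (‖ξ‖ ^ 2 + ‖ζ‖ ^ 2) := by
  obtain ⟨hs, he⟩ := h x hx
  have h0 : ∀ ξ, 0 ≤ coeffForm (a x) ξ ξ := fun ξ => le_trans (by positivity) (he ξ).1
  have h1 := h0 ((1 : ℝ) • ξ + (1 : ℝ) • ζ)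
  have h2 := h0 ((1 : ℝ) • ξ + (-1 : ℝ) • ζ)
  rw [coeffForm_combination hs] at h1 h2
  have h3 : coeffForm (a x) ξ ξ ≤ _ := (he ξ).2
  have h4 : coeffForm (a x) ζ ζ ≤ _ := (he ζ).2
  have h5 := h0 ξ
  have h6 := h0 ζ
  rw [abs_le]
  constructor <;> linarith

lemma IsEllipticSolution.integrable_coeffForm (h : IsEllipticSolution lam a v) (hlam : 0 < lam)
    {φ : EuclideanSpace ℝ (Fin n) → ℝ} (hφ : ContDiff ℝ 1 φ) (h2φ : HasCompactSupport φ)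
    (h3φ : tsupport φ ⊆ ball 0 1) :
    Integrable fun x => coeffForm (a x) (gradient φ x) (gradient v x) := by
  have hgφ := continuous_gradient hφ
  have hgv := continuous_gradient h.contDiff
  have hK : IsCompact (tsupport φ) := h2φ
  have hg : Integrable ((tsupport φ).indicator
      fun x => lam⁻¹ * (‖gradient v x‖ ^ 2 + ‖gradient φ x‖ ^ 2)) := by
    rw [integrable_indicator_iff hK.measurableSet]
    exact ContinuousOn.integrableOn_compact hK (by fun_prop)
  refine hg.mono' ?_ (Filter.Eventually.of_forall fun x => ?_)
  · refine Measurable.aestronglyMeasurable ?_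
    unfold coeffForm
    refine Finset.measurable_sum _ fun i _ => Finset.measurable_sum _ fun j _ => ?_
    have h1 : Measurable fun x => gradient φ x i :=
      (by fun_prop : Continuous fun x => gradient φ x i).measurable
    have h2 : Measurable fun x => gradient v x j :=
      (by fun_prop : Continuous fun x => gradient v x j).measurable
    exact (h1.mul (h.measurable i j)).mul h2
  · by_cases hx : x ∈ tsupport φ
    · rw [Set.indicator_of_mem hx, Real.norm_eq_abs]
      exact h.elliptic.abs_coeffForm_le hlam (h3φ hx) _ _
    · rw [Set.indicator_of_notMem hx]
      simp [coeffForm, gradient_eq_zero_of_notMem_tsupport hx]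

/-- The energy (Caccioppoli) inequality obtained by testing with `η² F`, where `F` is a function of
the solution with `∇F = F' ∇v`. -/
lemma IsEllipticSolution.caccioppoli (h : IsEllipticSolution lam a v) (hlam : 0 < lam)
    {η F F' G : EuclideanSpace ℝ (Fin n) → ℝ} (hη : HasCompactSupport η)
    (hηs : tsupport η ⊆ ball 0 1) (hφ : ContDiff ℝ 1 fun x => η x ^ 2 * F x)
    (hgrad : ∀ x ∈ tsupport η, gradient (fun x => η x ^ 2 * F x) x =
      (η x ^ 2 * F' x) • gradient v x + (2 * η x * F x) • gradient η x)
    (hF' : ∀ x ∈ tsupport η, 0 ≤ F' x) (hG : ∀ x ∈ tsupport η, 0 ≤ G x)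
    (hFG : ∀ x ∈ tsupport η, F x ^ 2 ≤ G x * F' x)
    (hi : Integrable fun x => η x ^ 2 * F' x * ‖gradient v x‖ ^ 2)
    (hi' : Integrable fun x => G x * ‖gradient η x‖ ^ 2) :
    ∫ x, η x ^ 2 * F' x * ‖gradient v x‖ ^ 2 ≤
      4 / lam ^ 2 * ∫ x, G x * ‖gradient η x‖ ^ 2 := by
  have hts : tsupport (fun x => η x ^ 2 * F x) ⊆ tsupport η := by
    refine closure_mono fun x hx => ?_
    contrapose! hx
    simp only [Function.mem_support, not_not] at hx ⊢
    simp [hx]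
  have h2φ : HasCompactSupport (fun x => η x ^ 2 * F x) :=
    hη.of_isClosed_subset (isClosed_tsupport _) hts
  have h3φ := hts.trans hηs
  have h0 := isWeakSolution_iff.1 h.weak _ hφ h2φ h3φ
  have hint := h.integrable_coeffForm hlam hφ h2φ h3φ
  have hle : ∫ x, (lam / 2 * (η x ^ 2 * F' x * ‖gradient v x‖ ^ 2) -
      2 / lam * (G x * ‖gradient η x‖ ^ 2)) ≤
      ∫ x, coeffForm (a x) (gradient (fun x => η x ^ 2 * F x) x) (gradient v x) := by
    refine integral_mono ((hi.const_mul _).sub (hi'.const_mul _)) hint fun x => ?_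
    by_cases hx : x ∈ tsupport η
    · obtain ⟨hs, he⟩ := h.elliptic x (hηs hx)
      simp only [hgrad x hx, coeffForm_add_left, coeffForm_smul_left]
      have h1 : lam * ‖gradient v x‖ ^ 2 ≤ coeffForm (a x) (gradient v x) (gradient v x) :=
        (he _).1
      have h2 : coeffForm (a x) (gradient η x) (gradient η x) ≤ lam⁻¹ * ‖gradient η x‖ ^ 2 :=
        (he _).2
      have h3 : 0 ≤ coeffForm (a x) (gradient η x) (gradient η x) :=
        le_trans (by positivity) (he _).1
      have h4 : 0 ≤ coeffForm (a x) ((η x * F' x) • gradient v x + (2 * F x) • gradient η x)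
          ((η x * F' x) • gradient v x + (2 * F x) • gradient η x) :=
        le_trans (by positivity) (he _).1
      rw [coeffForm_combination hs] at h4
      set p := coeffForm (a x) (gradient v x) (gradient v x)
      set q := coeffForm (a x) (gradient η x) (gradient η x)
      set t := coeffForm (a x) (gradient η x) (gradient v x)
      have hF'x := hF' x hx
      have hGx := hG x hx
      have hFGx := hFG x hx
      have key : 0 ≤ 1 / 2 * (η x ^ 2 * F' x) * p + 2 * η x * F x * t + 2 * G x * q := by
        rcases hF'x.eq_or_lt with h5 | h5
        · rw [← h5, mul_zero] at hFGx
          have : F x = 0 := by nlinarith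
          rw [← h5, this]
          simp only [mul_zero, zero_mul, zero_add]
          positivity
        · have h6 : F x ^ 2 * q ≤ G x * F' x * q := by gcongr
          refine nonneg_of_mul_nonneg_right (a := F' x) ?_ h5
          nlinarith
      have h6 : η x ^ 2 * F' x * (lam * ‖gradient v x‖ ^ 2) ≤ η x ^ 2 * F' x * p := by gcongr
      have h7 : G x * q ≤ G x * (lam⁻¹ * ‖gradient η x‖ ^ 2) := by gcongr
      have h8 : 2 / lam * (G x * ‖gradient η x‖ ^ 2) =
          2 * (G x * (lam⁻¹ * ‖gradient η x‖ ^ 2)) := by ring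
      rw [h8]
      nlinarith
    · have h1 : η x = 0 := image_eq_zero_of_notMem_tsupport hx
      simp [h1, gradient_eq_zero_of_notMem_tsupport hx, coeffForm,
        gradient_eq_zero_of_notMem_tsupport fun hh => hx (hts hh)]
  rw [h0, integral_sub (hi.const_mul _) (hi'.const_mul _), integral_const_mul,
    integral_const_mul] at hle
  have h9 : 4 / lam ^ 2 * ∫ x, G x * ‖gradient η x‖ ^ 2 =
      2 / lam * (2 / lam * ∫ x, G x * ‖gradient η x‖ ^ 2) := by ring
  rw [h9]
  calc _ = 2 / lam * (lam / 2 * ∫ x, η x ^ 2 * F' x * ‖gradient v x‖ ^ 2) := by field_simp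
    _ ≤ _ := mul_le_mul_of_nonneg_left (by linarith) (by positivity)

end WeakSolutions

section DeGiorgi

variable {n : ℕ} {lam : ℝ} {a : EuclideanSpace ℝ (Fin n) → Matrix (Fin n) (Fin n) ℝ}
  {v : EuclideanSpace ℝ (Fin n) → ℝ}

lemma hasDerivAt_max_zero_pow (m : ℕ) (t : ℝ) :
    HasDerivAt (fun t : ℝ => max t 0 ^ (m + 2)) ((m + 2 : ℕ) * max t 0 ^ (m + 1)) t := by
  rcases lt_trichotomy t 0 with ht | rfl | ht
  · have : (fun t : ℝ => max t 0 ^ (m + 2)) =ᶠ[nhds t] fun _ => 0 := by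
      filter_upwards [gt_mem_nhds ht] with s hs
      simp [max_eq_right hs.le]
    rw [max_eq_right ht.le]
    simpa using (hasDerivAt_const t (0 : ℝ)).congr_of_eventuallyEq this
  · have h1 : HasDerivWithinAt (fun t : ℝ => max t 0 ^ (m + 2)) 0 (Set.Iic 0) 0 :=
      (hasDerivWithinAt_const (0 : ℝ) (Set.Iic 0) (0 : ℝ)).congr
        (fun s hs => by simp [max_eq_right (Set.mem_Iic.1 hs)]) (by simp)
    have h2 : HasDerivWithinAt (fun t : ℝ => max t 0 ^ (m + 2)) 0 (Set.Ici 0) 0 := by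
      have := (hasDerivAt_pow (m + 2) (0 : ℝ)).hasDerivWithinAt (s := Set.Ici 0)
      simp only [Nat.add_succ_sub_one, ne_eq, Nat.add_eq_zero_iff, one_ne_zero, and_false,
        not_false_eq_true, zero_pow, mul_zero] at this
      exact this.congr (fun s hs => by simp [max_eq_left (Set.mem_Ici.1 hs)]) (by simp)
    have := h1.union h2
    rw [Set.Iic_union_Ici, hasDerivWithinAt_univ] at this
    simpa using this
  · have : (fun t : ℝ => max t 0 ^ (m + 2)) =ᶠ[nhds t] fun t => t ^ (m + 2) := by
      filter_upwards [lt_mem_nhds ht] with s hs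
      simp [max_eq_left hs.le]
    rw [max_eq_left ht.le]
    simpa using (hasDerivAt_pow (m + 2) t).congr_of_eventuallyEq this

lemma contDiff_max_zero_pow (m : ℕ) : ContDiff ℝ 1 fun t : ℝ => max t 0 ^ (m + 2) := by
  rw [contDiff_one_iff_deriv]
  refine ⟨fun t => (hasDerivAt_max_zero_pow m t).differentiableAt, ?_⟩
  rw [funext fun t => (hasDerivAt_max_zero_pow m t).deriv]
  fun_prop

lemma gradient_mul {f g : EuclideanSpace ℝ (Fin n) → ℝ} {x : EuclideanSpace ℝ (Fin n)}
    (hf : DifferentiableAt ℝ f x) (hg : DifferentiableAt ℝ g x) :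
    gradient (fun x => f x * g x) x = f x • gradient g x + g x • gradient f x := by
  have : fderiv ℝ (fun x => f x * g x) x = f x • fderiv ℝ g x + g x • fderiv ℝ f x :=
    (hf.hasFDerivAt.mul hg.hasFDerivAt).fderiv
  simp [gradient, this]

lemma gradient_comp {f : EuclideanSpace ℝ (Fin n) → ℝ} {g : ℝ → ℝ} {g' : ℝ}
    {x : EuclideanSpace ℝ (Fin n)} (hg : HasDerivAt g g' (f x)) (hf : DifferentiableAt ℝ f x) :
    gradient (fun x => g (f x)) x = g' • gradient f x := by
  have : fderiv ℝ (fun x => g (f x)) x = g' • fderiv ℝ f x :=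
    (hg.comp_hasFDerivAt x hf.hasFDerivAt).fderiv
  simp [gradient, this]

/-- The `C¹` cutoff function `((ρ² - |x|²)₊)²`. -/
def ballCutoff (ρ : ℝ) (x : EuclideanSpace ℝ (Fin n)) : ℝ := max (ρ ^ 2 - ‖x‖ ^ 2) 0 ^ 2

lemma contDiff_ballCutoff (ρ : ℝ) :
    ContDiff ℝ 1 (ballCutoff ρ : EuclideanSpace ℝ (Fin n) → ℝ) :=
  (contDiff_max_zero_pow 0).comp (contDiff_const.sub (contDiff_norm_sq ℝ))

lemma ballCutoff_eq_zero {ρ : ℝ} (hρ : 0 ≤ ρ) {x : EuclideanSpace ℝ (Fin n)} (hx : x ∉ ball 0 ρ) :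
    ballCutoff ρ x = 0 := by
  rw [mem_ball_zero_iff, not_lt] at hx
  have : ρ ^ 2 - ‖x‖ ^ 2 ≤ 0 := by nlinarith
  simp [ballCutoff, max_eq_right this]

lemma tsupport_ballCutoff_subset {ρ : ℝ} (hρ : 0 ≤ ρ) :
    tsupport (ballCutoff ρ : EuclideanSpace ℝ (Fin n) → ℝ) ⊆ closedBall 0 ρ := by
  refine closure_minimal (fun x hx => ?_) isClosed_closedBall
  by_contra h
  exact hx (ballCutoff_eq_zero hρ fun h' => h (ball_subset_closedBall h'))

lemma hasCompactSupport_ballCutoff {ρ : ℝ} (hρ : 0 ≤ ρ) :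
    HasCompactSupport (ballCutoff ρ : EuclideanSpace ℝ (Fin n) → ℝ) :=
  HasCompactSupport.of_support_subset_isCompact (isCompact_closedBall 0 ρ)
    (subset_closure.trans (tsupport_ballCutoff_subset hρ))

lemma gradient_ballCutoff (ρ : ℝ) (x : EuclideanSpace ℝ (Fin n)) :
    gradient (ballCutoff ρ) x = (-4 * max (ρ ^ 2 - ‖x‖ ^ 2) 0) • x := by
  have h1 : HasFDerivAt (fun x : EuclideanSpace ℝ (Fin n) => ρ ^ 2 - ‖x‖ ^ 2)
      (-(2 • innerSL ℝ x)) x := (hasStrictFDerivAt_norm_sq x).hasFDerivAt.const_sub _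
  have h2 := gradient_comp (hasDerivAt_max_zero_pow 0 _) h1.differentiableAt
  have h3 : gradient (fun x : EuclideanSpace ℝ (Fin n) => ρ ^ 2 - ‖x‖ ^ 2) x = (-2 : ℝ) • x := by
    rw [gradient, h1.fderiv]
    apply (InnerProductSpace.toDual ℝ _).injective
    ext y
    simp
  rw [h3, smul_smul] at h2
  rw [show ballCutoff ρ = fun x : EuclideanSpace ℝ (Fin n) => max (ρ ^ 2 - ‖x‖ ^ 2) 0 ^ (0 + 2)
    from rfl, h2]
  congr 1
  push_cast
  ring

lemma norm_gradient_ballCutoff_le {ρ : ℝ} (hρ : 0 ≤ ρ) (hρ1 : ρ ≤ 1)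
    (x : EuclideanSpace ℝ (Fin n)) :
    ‖gradient (ballCutoff ρ) x‖ ^ 2 ≤ (ball 0 ρ).indicator (fun _ => 16) x := by
  rw [gradient_ballCutoff, norm_smul]
  by_cases hx : x ∈ ball 0 ρ
  · rw [Set.indicator_of_mem hx]
    rw [mem_ball_zero_iff] at hx
    have h0 := norm_nonneg x
    have h1 : 0 ≤ ρ ^ 2 - ‖x‖ ^ 2 := by nlinarith
    have h2 : ρ ^ 2 - ‖x‖ ^ 2 ≤ 1 := by nlinarith
    rw [max_eq_left h1, Real.norm_eq_abs, abs_mul, abs_of_nonneg h1]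
    have h3 : (ρ ^ 2 - ‖x‖ ^ 2) * ‖x‖ ≤ 1 := mul_le_one₀ h2 h0 (by linarith)
    have h4 : 0 ≤ (ρ ^ 2 - ‖x‖ ^ 2) * ‖x‖ := by positivity
    norm_num
    nlinarith
  · rw [Set.indicator_of_notMem hx]
    rw [mem_ball_zero_iff, not_lt] at hx
    have : ρ ^ 2 - ‖x‖ ^ 2 ≤ 0 := by nlinarith
    simp [max_eq_right this]

lemma le_ballCutoff {r ρ : ℝ} (hr : 1 / 4 ≤ r) (hrρ : r ≤ ρ) {x : EuclideanSpace ℝ (Fin n)}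
    (hx : x ∈ ball 0 r) : (ρ - r) ^ 2 / 4 ≤ ballCutoff ρ x := by
  rw [mem_ball_zero_iff] at hx
  have h0 := norm_nonneg x
  have h1 : (ρ - r) / 2 ≤ ρ ^ 2 - ‖x‖ ^ 2 := by nlinarith
  have h2 : 0 ≤ (ρ - r) / 2 := by linarith
  rw [ballCutoff, max_eq_left (h2.trans h1)]
  nlinarith

lemma exists_forall_tendsto_zero_of_rpow_recurrence {K b δ : ℝ} (hK : 0 < K) (hb : 1 < b)
    (hδ : 0 < δ) :
    ∃ ν > (0 : ℝ), ∀ A : ℕ → ℝ, (∀ j, 0 ≤ A j) → (∀ j, A (j + 1) ≤ K * b ^ j * A j ^ δ * A j) →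
      A 0 ≤ ν → Filter.Tendsto A Filter.atTop (nhds 0) := by
  have hb0 : 0 < b := by linarith
  set q : ℝ := b ^ (-(1 / δ)) with hq
  have hq0 : 0 < q := by positivity
  have hq1 : q < 1 := Real.rpow_lt_one_of_one_lt_of_neg hb (by simpa using hδ)
  have hbq : b * q ^ δ = 1 := by
    rw [hq, ← Real.rpow_mul hb0.le, neg_mul, one_div_mul_cancel hδ.ne', Real.rpow_neg_one,
      mul_inv_cancel₀ hb0.ne']
  set ν : ℝ := (q / K) ^ (1 / δ) with hν
  have hν0 : 0 < ν := by positivity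
  have hKν : K * ν ^ δ = q := by
    rw [hν, ← Real.rpow_mul (by positivity), one_div_mul_cancel hδ.ne', Real.rpow_one,
      mul_div_cancel₀ _ hK.ne']
  refine ⟨ν, hν0, fun A hA0 hA hA1 => ?_⟩
  have hle : ∀ j, A j ≤ ν * q ^ j := by
    intro j
    induction j with
    | zero => simpa using hA1
    | succ j ih =>
      calc A (j + 1) ≤ K * b ^ j * A j ^ δ * A j := hA j
        _ ≤ K * b ^ j * (ν * q ^ j) ^ δ * (ν * q ^ j) := by
          have := hA0 j
          gcongr
        _ = (K * ν ^ δ) * (b * q ^ δ) ^ j * (ν * q ^ j) := by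
          rw [Real.mul_rpow hν0.le (by positivity), mul_pow, ← Real.rpow_natCast,
            ← Real.rpow_natCast, ← Real.rpow_natCast, ← Real.rpow_mul hq0.le,
            ← Real.rpow_mul hq0.le, mul_comm (j : ℝ) δ]
          ring
        _ = ν * q ^ (j + 1) := by rw [hKν, hbq]; ring
  refine squeeze_zero hA0 hle ?_
  simpa using (tendsto_pow_atTop_nhds_zero_of_lt_one hq0.le hq1).const_mul ν

lemma integrableOn_ball_of_continuous {f : EuclideanSpace ℝ (Fin n) → ℝ} (hf : Continuous f)
    (r : ℝ) : IntegrableOn f (ball 0 r) :=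
  (hf.continuousOn.integrableOn_compact (isCompact_closedBall 0 r)).mono_set
    ball_subset_closedBall

/-- Caccioppoli's inequality for `(v - l)₊²`. -/
lemma IsEllipticSolution.integral_gradient_truncation_le (h : IsEllipticSolution lam a v)
    (hlam : 0 < lam) {ρ : ℝ} (hρ : 0 ≤ ρ) (hρ1 : ρ < 1) (l : ℝ) :
    ∫ x, ‖gradient (fun x => ballCutoff ρ x * max (v x - l) 0 ^ 2) x‖ ^ 2 ≤
      16 * (2 + 4 / lam ^ 2) * ∫ x in ball 0 ρ, max (v x - l) 0 ^ 4 := by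
  set η : EuclideanSpace ℝ (Fin n) → ℝ := ballCutoff ρ with hη
  have hηc : ContDiff ℝ 1 η := contDiff_ballCutoff ρ
  have hηs : HasCompactSupport η := hasCompactSupport_ballCutoff hρ
  have hvc := h.contDiff
  have hvl : ContDiff ℝ 1 fun x => v x - l := hvc.sub contDiff_const
  have hgη := continuous_gradient hηc
  have hgv := continuous_gradient hvc
  have cη := hηc.continuous
  have cv := hvc.continuous
  have hglv : ∀ x, gradient (fun x => v x - l) x = gradient v x := by
    intro x
    simp [gradient, fderiv_sub_const]
  have hgT : ∀ (m : ℕ) x, gradient (fun x => max (v x - l) 0 ^ (m + 2)) x =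
      ((m + 2 : ℕ) * max (v x - l) 0 ^ (m + 1)) • gradient v x := by
    intro m x
    rw [gradient_comp (f := fun x => v x - l) (hasDerivAt_max_zero_pow m _)
      (hvl.differentiable one_ne_zero x), hglv]
  have hTc : ∀ m : ℕ, ContDiff ℝ 1 fun x => max (v x - l) 0 ^ (m + 2) :=
    fun m => (contDiff_max_zero_pow m).comp hvl
  have hη0 : ∀ x, x ∉ tsupport η → η x = 0 := fun x hx => image_eq_zero_of_notMem_tsupport hx
  have hη0' : ∀ x, x ∉ tsupport η → gradient η x = 0 :=
    fun x hx => gradient_eq_zero_of_notMem_tsupport hx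
  have i1 : Integrable fun x => η x ^ 2 * (3 * max (v x - l) 0 ^ 2) * ‖gradient v x‖ ^ 2 :=
    Continuous.integrable_of_hasCompactSupport (by fun_prop)
      (HasCompactSupport.intro hηs fun x hx => by simp [hη0 x hx])
  have i2 : Integrable fun x => max (v x - l) 0 ^ 4 / 3 * ‖gradient η x‖ ^ 2 :=
    Continuous.integrable_of_hasCompactSupport (by fun_prop)
      (HasCompactSupport.intro hηs fun x hx => by simp [hη0' x hx])
  have hcac := h.caccioppoli hlam (η := η) (F := fun x => max (v x - l) 0 ^ 3)
    (F' := fun x => 3 * max (v x - l) 0 ^ 2) (G := fun x => max (v x - l) 0 ^ 4 / 3) hηs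
    ((tsupport_ballCutoff_subset hρ).trans (closedBall_subset_ball hρ1))
    ((hηc.pow 2).mul (hTc 1))
    (fun x _ => by
      rw [gradient_mul ((hηc.pow 2).differentiable one_ne_zero x)
        ((hTc 1).differentiable one_ne_zero x), hgT 1,
        gradient_comp (hasDerivAt_pow 2 (η x)) (hηc.differentiable one_ne_zero x), smul_smul,
        smul_smul]
      congr 2
      push_cast
      ring)
    (fun x _ => by positivity) (fun x _ => by positivity) (fun x _ => le_of_eq (by ring)) i1 i2
  have hgw : ∀ x, gradient (fun x => η x * max (v x - l) 0 ^ 2) x =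
      (2 * η x * max (v x - l) 0) • gradient v x + max (v x - l) 0 ^ 2 • gradient η x := by
    intro x
    rw [gradient_mul (hηc.differentiable one_ne_zero x) ((hTc 0).differentiable one_ne_zero x),
      hgT 0, smul_smul]
    congr 2
    push_cast
    ring
  have hw : ∫ x, ‖gradient (fun x => η x * max (v x - l) 0 ^ 2) x‖ ^ 2 ≤
      ∫ x, (8 / 3 * (η x ^ 2 * (3 * max (v x - l) 0 ^ 2) * ‖gradient v x‖ ^ 2) +
        6 * (max (v x - l) 0 ^ 4 / 3 * ‖gradient η x‖ ^ 2)) := by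
    refine integral_mono_of_nonneg (Filter.Eventually.of_forall fun x => by positivity)
      ((i1.const_mul _).add (i2.const_mul _)) (Filter.Eventually.of_forall fun x => ?_)
    simp only [hgw]
    have h1 := norm_add_le ((2 * η x * max (v x - l) 0) • gradient v x)
      (max (v x - l) 0 ^ 2 • gradient η x)
    rw [norm_smul, norm_smul] at h1
    have h2 : ‖2 * η x * max (v x - l) 0‖ ^ 2 = 4 * η x ^ 2 * max (v x - l) 0 ^ 2 := by
      rw [Real.norm_eq_abs, sq_abs]; ring
    have h3 : ‖max (v x - l) 0 ^ 2‖ ^ 2 = max (v x - l) 0 ^ 4 := by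
      rw [Real.norm_eq_abs, sq_abs]; ring
    calc _ ≤ (‖2 * η x * max (v x - l) 0‖ * ‖gradient v x‖ +
          ‖max (v x - l) 0 ^ 2‖ * ‖gradient η x‖) ^ 2 := by gcongr
      _ ≤ 2 * (‖2 * η x * max (v x - l) 0‖ ^ 2 * ‖gradient v x‖ ^ 2) +
          2 * (‖max (v x - l) 0 ^ 2‖ ^ 2 * ‖gradient η x‖ ^ 2) := by
        nlinarith [sq_nonneg (‖2 * η x * max (v x - l) 0‖ * ‖gradient v x‖ -
          ‖max (v x - l) 0 ^ 2‖ * ‖gradient η x‖)]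
      _ = _ := by rw [h2, h3]; ring
  rw [integral_add (i1.const_mul _) (i2.const_mul _), integral_const_mul, integral_const_mul] at hw
  have hI : ∫ x, max (v x - l) 0 ^ 4 / 3 * ‖gradient η x‖ ^ 2 ≤
      16 / 3 * ∫ x in ball 0 ρ, max (v x - l) 0 ^ 4 := by
    rw [← integral_const_mul, ← integral_indicator measurableSet_ball]
    refine integral_mono i2 ?_ fun x => ?_
    · rw [integrable_indicator_iff measurableSet_ball]
      exact integrableOn_ball_of_continuous (by fun_prop) ρ
    · have h1 := norm_gradient_ballCutoff_le hρ hρ1.le x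
      have h2 : 0 ≤ max (v x - l) 0 ^ 4 / 3 := by positivity
      refine (mul_le_mul_of_nonneg_left h1 h2).trans_eq ?_
      by_cases hx : x ∈ ball 0 ρ
      · simp only [Set.indicator_of_mem hx]
        ring
      · simp only [Set.indicator_of_notMem hx, mul_zero]
  have h0 : 0 ≤ ∫ x in ball 0 ρ, max (v x - l) 0 ^ 4 := integral_nonneg fun x => by positivity
  set I := ∫ x in ball 0 ρ, max (v x - l) 0 ^ 4
  calc _ ≤ _ := hw
    _ ≤ 8 / 3 * (4 / lam ^ 2 * (16 / 3 * I)) + 6 * (16 / 3 * I) := by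
      gcongr
      exact hcac.trans (by gcongr)
    _ ≤ 16 * (2 + 4 / lam ^ 2) * I := by
      have : 0 ≤ 4 / lam ^ 2 * I := by positivity
      nlinarith

/-- One step of De Giorgi's iteration. -/
lemma IsEllipticSolution.deGiorgi_step (hn : 1 ≤ n) (hlam : 0 < lam) :
    ∃ K > (0 : ℝ), ∀ (a : EuclideanSpace ℝ (Fin n) → Matrix (Fin n) (Fin n) ℝ)
      (v : EuclideanSpace ℝ (Fin n) → ℝ), IsEllipticSolution lam a v →
      ∀ r ρ k l : ℝ, 1 / 4 ≤ r → r < ρ → ρ ≤ 1 / 2 → k < l →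
        (ρ - r) ^ 4 * ∫ x in ball 0 r, max (v x - l) 0 ^ 4 ≤
          K * ((∫ x in ball 0 ρ, max (v x - k) 0 ^ 4) / (l - k) ^ 4) ^ (2 / n : ℝ) *
            ∫ x in ball 0 ρ, max (v x - k) 0 ^ 4 := by
  obtain ⟨C, hC0, hC⟩ := integral_sq_le_measure_rpow_mul_integral_gradient_sq hn
  refine ⟨16 * (C * (16 * (2 + 4 / lam ^ 2))), by positivity,
    fun a v h r ρ k l hr hrρ hρ hkl => ?_⟩
  have cv := h.contDiff.continuous
  have hρ0 : 0 ≤ ρ := by linarith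
  set w : EuclideanSpace ℝ (Fin n) → ℝ := fun x => ballCutoff ρ x * max (v x - l) 0 ^ 2 with hw
  have hwc : ContDiff ℝ 1 w := (contDiff_ballCutoff ρ).mul
    ((contDiff_max_zero_pow 0).comp (h.contDiff.sub contDiff_const))
  have hws : HasCompactSupport w := (hasCompactSupport_ballCutoff hρ0).mul_right
  set S : Set (EuclideanSpace ℝ (Fin n)) := ball 0 ρ ∩ {x | l < v x} with hS
  have hSm : MeasurableSet S :=
    measurableSet_ball.inter (isOpen_lt continuous_const cv).measurableSet
  have hSf : volume S ≠ ⊤ := measure_ne_top_of_subset Set.inter_subset_left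
    measure_ball_lt_top.ne
  have h1 := hC w hwc hws S hSm hSf fun x hx => by
    by_cases hxb : x ∈ ball 0 ρ
    · have : v x - l ≤ 0 := by
        by_contra hlt
        exact hx ⟨hxb, by simp at hlt; exact hlt⟩
      simp [hw, max_eq_right this]
    · simp [hw, ballCutoff_eq_zero hρ0 hxb]
  have h2 := h.integral_gradient_truncation_le hlam hρ0 (by linarith) l
  set I := ∫ x in ball 0 ρ, max (v x - k) 0 ^ 4 with hI
  have hint : ∀ s t : ℝ, IntegrableOn (fun x => max (v x - t) 0 ^ 4) (ball 0 s) :=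
    fun s t => integrableOn_ball_of_continuous (by fun_prop) s
  have hI0 : 0 ≤ I := integral_nonneg fun x => by positivity
  have h3 : ∫ x in ball 0 ρ, max (v x - l) 0 ^ 4 ≤ I := by
    refine integral_mono (hint ρ l) (hint ρ k) fun x => ?_
    dsimp only
    gcongr
  have h4 : volume.real S ≤ I / (l - k) ^ 4 := by
    have hlk : 0 < (l - k) ^ 4 := by have := sub_pos.2 hkl; positivity
    rw [le_div_iff₀ hlk]
    calc volume.real S * (l - k) ^ 4 = ∫ x in S, (l - k) ^ 4 := by simp
      _ ≤ ∫ x in S, max (v x - k) 0 ^ 4 := by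
        refine setIntegral_mono_on (integrableOn_const hSf)
          ((hint ρ k).mono_set Set.inter_subset_left) hSm fun x hx => ?_
        have h5 : l < v x := hx.2
        have h6 : l - k ≤ max (v x - k) 0 := le_max_of_le_left (by linarith)
        have h7 : 0 ≤ l - k := by linarith
        gcongr
      _ ≤ I := setIntegral_mono_set (hint ρ k)
        (Filter.Eventually.of_forall fun x => by positivity)
        (Filter.Eventually.of_forall fun x hx => hx.1)
  have h5 : (ρ - r) ^ 4 / 16 * ∫ x in ball 0 r, max (v x - l) 0 ^ 4 ≤ ∫ x, w x ^ 2 := by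
    have hwi : Integrable fun x => w x ^ 2 := by
      have := hwc.continuous
      exact Continuous.integrable_of_hasCompactSupport (by fun_prop)
        (hws.comp_left (g := fun t => t ^ 2) (by simp))
    rw [← integral_const_mul]
    refine le_trans (setIntegral_mono_on ((hint r l).const_mul _) hwi.integrableOn
      measurableSet_ball fun x hx => ?_) (setIntegral_le_integral hwi
        (Filter.Eventually.of_forall fun x => by positivity))
    have h6 := le_ballCutoff hr hrρ.le hx
    have h7 : ((ρ - r) ^ 2 / 4) ^ 2 ≤ ballCutoff ρ x ^ 2 := by gcongr
    calc _ = ((ρ - r) ^ 2 / 4) ^ 2 * max (v x - l) 0 ^ 4 := by ring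
      _ ≤ ballCutoff ρ x ^ 2 * max (v x - l) 0 ^ 4 := by gcongr
      _ = w x ^ 2 := by simp only [hw]; ring
  have h6 : ∫ x, w x ^ 2 ≤
      C * (I / (l - k) ^ 4) ^ (2 / n : ℝ) * (16 * (2 + 4 / lam ^ 2) * I) := by
    refine h1.trans ?_
    gcongr
    exact h2.trans (by gcongr)
  calc _ = 16 * ((ρ - r) ^ 4 / 16 * ∫ x in ball 0 r, max (v x - l) 0 ^ 4) := by ring
    _ ≤ 16 * (C * (I / (l - k) ^ 4) ^ (2 / n : ℝ) * (16 * (2 + 4 / lam ^ 2) * I)) := by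
      exact mul_le_mul_of_nonneg_left (h5.trans h6) (by norm_num)
    _ = _ := by ring

/-- **De Giorgi's first lemma**: a solution bounded by `1` that is positive only on a set of small
measure is bounded by `1 / 2` in a smaller ball. -/
lemma IsEllipticSolution.le_half_of_measure_pos_le (hn : 1 ≤ n) (hlam : 0 < lam) :
    ∃ ν > (0 : ℝ), ∀ (a : EuclideanSpace ℝ (Fin n) → Matrix (Fin n) (Fin n) ℝ)
      (v : EuclideanSpace ℝ (Fin n) → ℝ), IsEllipticSolution lam a v →
      (∀ x ∈ ball 0 (1 / 2), v x ≤ 1) → volume.real (ball 0 (1 / 2) ∩ {x | 0 < v x}) ≤ ν →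
      ∀ x ∈ ball 0 (1 / 4), v x ≤ 1 / 2 := by
  obtain ⟨K, hK0, hK⟩ := IsEllipticSolution.deGiorgi_step hn hlam
  have hn0 : (0 : ℝ) < n := by exact_mod_cast hn
  have hδ : (0 : ℝ) < 2 / n := by positivity
  have h16 : (1 : ℝ) < 16 ^ (2 / n : ℝ) := Real.one_lt_rpow (by norm_num) hδ
  obtain ⟨ν, hν0, hν⟩ := exists_forall_tendsto_zero_of_rpow_recurrence
    (K := 8 ^ 4 * K * (4 ^ 4) ^ (2 / n : ℝ)) (b := 16 * 16 ^ (2 / n : ℝ)) (δ := 2 / n)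
    (by positivity) (by linarith) hδ
  refine ⟨ν, hν0, fun a v h hv1 hvν => ?_⟩
  have cv := h.contDiff.continuous
  have hint : ∀ s t : ℝ, IntegrableOn (fun x => max (v x - t) 0 ^ 4) (ball 0 s) :=
    fun s t => integrableOn_ball_of_continuous (by fun_prop) s
  set A : ℕ → ℝ := fun j => ∫ x in ball 0 (1 / 4 + (1 / 2) ^ j / 4),
    max (v x - 1 / 2 * (1 - (1 / 2) ^ j)) 0 ^ 4 with hA
  have hA0 : ∀ j, 0 ≤ A j := fun j => integral_nonneg fun x => by positivity
  have hlim := hν A hA0 ?_ ?_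
  · have hle : ∀ j, ∫ x in ball 0 (1 / 4), max (v x - 1 / 2) 0 ^ 4 ≤ A j := by
      intro j
      have hj : (0 : ℝ) < (1 / 2) ^ j := by positivity
      calc _ ≤ ∫ x in ball 0 (1 / 4), max (v x - 1 / 2 * (1 - (1 / 2) ^ j)) 0 ^ 4 := by
            refine integral_mono (hint _ _) (hint _ _) fun x => ?_
            dsimp only
            gcongr
            linarith
        _ ≤ _ := setIntegral_mono_set (hint _ _)
          (Filter.Eventually.of_forall fun x => by positivity)
          (Filter.Eventually.of_forall fun x hx => ball_subset_ball (by linarith) hx)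
    have h0 : ∫ x in ball 0 (1 / 4), max (v x - 1 / 2) 0 ^ 4 = 0 :=
      le_antisymm (ge_of_tendsto' hlim hle) (integral_nonneg fun x => by positivity)
    rw [setIntegral_eq_zero_iff_of_nonneg_ae (Filter.Eventually.of_forall fun x => by positivity)
      (hint _ _)] at h0
    have heq := Measure.eqOn_open_of_ae_eq h0 isOpen_ball
      (Continuous.continuousOn (by fun_prop)) continuousOn_const
    intro x hx
    have hx0 : max (v x - 1 / 2) 0 ^ 4 = 0 := heq hx
    have := le_max_left (v x - 1 / 2) 0
    rw [pow_eq_zero_iff (by norm_num)] at hx0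
    linarith
  · intro j
    have hj : (0 : ℝ) < (1 / 2) ^ j := by positivity
    have hj1 : ((1 / 2) ^ j : ℝ) ≤ 1 := pow_le_one₀ (by norm_num) (by norm_num)
    have hs := hK a v h (1 / 4 + (1 / 2) ^ (j + 1) / 4) (1 / 4 + (1 / 2) ^ j / 4)
      (1 / 2 * (1 - (1 / 2) ^ j)) (1 / 2 * (1 - (1 / 2) ^ (j + 1))) (by linarith [pow_succ (1 / 2 : ℝ) j])
      (by linarith [pow_succ (1 / 2 : ℝ) j]) (by linarith) (by linarith [pow_succ (1 / 2 : ℝ) j])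
    have e1 : (1 / 4 + (1 / 2) ^ j / 4 - (1 / 4 + (1 / 2) ^ (j + 1) / 4) : ℝ) ^ 4 =
        (8 ^ 4 * 16 ^ j)⁻¹ := by
      rw [show (16 : ℝ) = 2 ^ 4 by norm_num, ← pow_mul, mul_comm 4 j, pow_mul, ← mul_pow,
        ← inv_pow]
      congr 1
      rw [pow_succ, one_div_pow]
      field_simp
      ring
    have e2 : (1 / 2 * (1 - (1 / 2) ^ (j + 1)) - 1 / 2 * (1 - (1 / 2) ^ j) : ℝ) ^ 4 =
        (4 ^ 4 * 16 ^ j)⁻¹ := by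
      rw [show (16 : ℝ) = 2 ^ 4 by norm_num, ← pow_mul, mul_comm 4 j, pow_mul, ← mul_pow,
        ← inv_pow]
      congr 1
      rw [pow_succ, one_div_pow]
      field_simp
      ring
    rw [e1, e2, div_inv_eq_mul, inv_mul_le_iff₀ (by positivity)] at hs
    refine hs.trans_eq ?_
    change _ * (K * (A j * _) ^ _ * A j) = _
    rw [Real.mul_rpow (hA0 j) (by positivity), Real.mul_rpow (by positivity) (by positivity),
      mul_pow, ← Real.rpow_natCast (16 ^ (2 / n : ℝ)), ← Real.rpow_mul (by norm_num),
      ← Real.rpow_natCast 16, ← Real.rpow_mul (by norm_num), mul_comm (j : ℝ)]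
    ring
  · refine le_trans ?_ hvν
    have hSm : MeasurableSet {x | 0 < v x} := (isOpen_lt continuous_const cv).measurableSet
    calc A 0 = ∫ x in ball 0 (1 / 2), max (v x) 0 ^ 4 := by simp [hA]; norm_num
      _ ≤ ∫ x in ball 0 (1 / 2), {x | 0 < v x}.indicator (fun _ => (1 : ℝ)) x := by
        refine setIntegral_mono_on (by simpa using hint (1 / 2) 0)
          ((integrableOn_const measure_ball_lt_top.ne).indicator hSm) measurableSet_ball
          fun x hx => ?_
        by_cases h0 : 0 < v x
        · rw [Set.indicator_of_mem (show x ∈ {x | 0 < v x} from h0), max_eq_left h0.le]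
          exact pow_le_one₀ h0.le (hv1 x hx)
        · rw [Set.indicator_of_notMem (show x ∉ {x | 0 < v x} from h0),
            max_eq_right (not_lt.1 h0)]
          norm_num
      _ = _ := by
        rw [setIntegral_indicator hSm]
        simp

end DeGiorgi

section Poincare

variable {n : ℕ}

lemma setLIntegral_comp_lineMap_le {B : Set (EuclideanSpace ℝ (Fin n))} (hB : Convex ℝ B)
    (hBm : MeasurableSet B) {g : EuclideanSpace ℝ (Fin n) → ENNReal} (hg : Measurable g)
    {y : EuclideanSpace ℝ (Fin n)} (hy : y ∈ B) {t : ℝ} (ht : 1 / 2 ≤ t) (ht1 : t ≤ 1) :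
    ∫⁻ x in B, g (AffineMap.lineMap y x t) ≤ 2 ^ n * ∫⁻ x in B, g x := by
  have ht0 : 0 < t := by linarith
  have hgB : Measurable (B.indicator g) := hg.indicator hBm
  have h1 : ∫⁻ x, B.indicator g (y - t • y + t • x) =
      ENNReal.ofReal |(t ^ n)⁻¹| * ∫⁻ x, B.indicator g x := by
    have h2 := Measure.map_addHaar_smul
      (volume : Measure (EuclideanSpace ℝ (Fin n))) ht0.ne'
    rw [finrank_euclideanSpace_fin] at h2
    rw [← smul_eq_mul, ← lintegral_add_left_eq_self (B.indicator g) (y - t • y), ← lintegral_smul_measure, ← h2,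
      lintegral_map (by fun_prop) (by fun_prop)]
  calc ∫⁻ x in B, g (AffineMap.lineMap y x t) ≤ ∫⁻ x, B.indicator g (y - t • y + t • x) := by
        rw [← lintegral_indicator hBm]
        refine lintegral_mono fun x => ?_
        by_cases hx : x ∈ B
        · have hl : AffineMap.lineMap y x t = y - t • y + t • x := by
            rw [AffineMap.lineMap_apply_module]
            module
          have hm : AffineMap.lineMap y x t ∈ B := hB.lineMap_mem hy hx ⟨ht0.le, ht1⟩
          rw [Set.indicator_of_mem hx, ← hl, Set.indicator_of_mem hm]
        · simp [Set.indicator_of_notMem hx]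
    _ = ENNReal.ofReal |(t ^ n)⁻¹| * ∫⁻ x in B, g x := by rw [h1, lintegral_indicator hBm]
    _ ≤ _ := by
      gcongr
      rw [abs_of_nonneg (by positivity), show (2 : ENNReal) ^ n = ENNReal.ofReal (2 ^ n) by
        rw [ENNReal.ofReal_pow (by norm_num)]; simp]
      refine ENNReal.ofReal_le_ofReal ?_
      rw [← inv_pow]
      gcongr
      rw [inv_le_comm₀ ht0 (by norm_num)]
      linarith

/-- The `L¹` Poincaré inequality on a ball, in terms of differences of values. -/
lemma lintegral_lintegral_enorm_sub_le {w : EuclideanSpace ℝ (Fin n) → ℝ}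
    (hw : ContDiffOn ℝ 1 w (ball 0 (1 / 2))) :
    ∫⁻ y in ball 0 (1 / 2), ∫⁻ x in ball 0 (1 / 2), ‖w x - w y‖ₑ ≤
      2 ^ n * (∫⁻ x in ball 0 (1 / 2), ‖fderiv ℝ w x‖ₑ) *
        volume (ball (0 : EuclideanSpace ℝ (Fin n)) (1 / 2)) := by
  set B := ball (0 : EuclideanSpace ℝ (Fin n)) (1 / 2) with hBdef
  set g : EuclideanSpace ℝ (Fin n) → ENNReal := fun x => ‖fderiv ℝ w x‖ₑ with hgdef
  have hg : Measurable g := (measurable_fderiv ℝ w).enorm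
  have hB : Convex ℝ B := convex_ball _ _
  have hBm : MeasurableSet B := measurableSet_ball
  have hpt : ∀ y ∈ B, ∀ x ∈ B, ‖w x - w y‖ₑ ≤
      ∫⁻ t in Set.Icc (0 : ℝ) 1, g (AffineMap.lineMap y x t) := by
    intro y hy x hx
    have hm : ∀ t ∈ Set.Icc (0 : ℝ) 1, (AffineMap.lineMap y x t : EuclideanSpace ℝ (Fin n)) ∈ B :=
      fun t ht => hB.lineMap_mem hy hx ht
    have hc : ContDiffOn ℝ 1 (fun t : ℝ => w (AffineMap.lineMap y x t)) (Set.Icc 0 1) := by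
      refine hw.comp (ContDiff.contDiffOn ?_) hm
      change ContDiff ℝ 1 fun t : ℝ => AffineMap.lineMap y x t
      simp only [AffineMap.lineMap_apply_module]
      fun_prop
    have h1 := enorm_sub_le_lintegral_deriv_of_contDiffOn_Icc hc zero_le_one
    simp only [AffineMap.lineMap_apply_one, AffineMap.lineMap_apply_zero] at h1
    refine h1.trans (setLIntegral_mono' measurableSet_Icc fun t ht => ?_)
    have hd : DifferentiableAt ℝ w (AffineMap.lineMap y x t) :=
      (hw.differentiableOn one_ne_zero).differentiableAt (isOpen_ball.mem_nhds (hm t ht))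
    have hd' := hd.hasFDerivAt.comp_hasDerivAt t
      (AffineMap.hasDerivAt_lineMap (a := y) (b := x) (x := t))
    have hxy : ‖x - y‖ ≤ 1 := by
      rw [hBdef, mem_ball_zero_iff] at hx hy
      linarith [norm_sub_le x y]
    rw [show (fun t : ℝ => w (AffineMap.lineMap y x t)) = w ∘ (AffineMap.lineMap y x) from rfl,
      hd'.deriv, hgdef, enorm_le_iff_norm_le]
    exact (ContinuousLinearMap.le_opNorm _ _).trans (mul_le_of_le_one_right (norm_nonneg _) hxy)
  have hmeas : Measurable fun p : (EuclideanSpace ℝ (Fin n) × ℝ) × EuclideanSpace ℝ (Fin n) =>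
      g (AffineMap.lineMap p.1.1 p.2 p.1.2) := by
    refine hg.comp (Continuous.measurable ?_)
    simp only [AffineMap.lineMap_apply_module]
    fun_prop
  have hslice : ∀ t ∈ Set.Icc (0 : ℝ) 1, ∫⁻ y in B, ∫⁻ x in B, g (AffineMap.lineMap y x t) ≤
      2 ^ n * (∫⁻ x in B, g x) * volume B := by
    intro t ht
    have key : ∀ s : ℝ, 1 / 2 ≤ s → s ≤ 1 →
        ∫⁻ y in B, ∫⁻ x in B, g (AffineMap.lineMap y x s) ≤
          2 ^ n * (∫⁻ x in B, g x) * volume B := by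
      intro s hs hs1
      calc _ ≤ ∫⁻ y in B, 2 ^ n * ∫⁻ x in B, g x :=
            setLIntegral_mono' hBm fun y hy => setLIntegral_comp_lineMap_le hB hBm hg hy hs hs1
        _ = _ := by rw [setLIntegral_const]
    rcases le_total (1 / 2) t with h | h
    · exact key t h ht.2
    · rw [lintegral_lintegral_swap]
      · simp only [← AffineMap.lineMap_apply_one_sub _ _ t]
        exact key (1 - t) (by linarith) (by linarith [ht.1])
      · refine Measurable.aemeasurable ?_
        exact hmeas.comp (f := fun p : EuclideanSpace ℝ (Fin n) × EuclideanSpace ℝ (Fin n) =>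
          ((p.1, t), p.2)) (by fun_prop)
  calc ∫⁻ y in B, ∫⁻ x in B, ‖w x - w y‖ₑ
      ≤ ∫⁻ y in B, ∫⁻ x in B, ∫⁻ t in Set.Icc (0 : ℝ) 1, g (AffineMap.lineMap y x t) :=
        setLIntegral_mono' hBm fun y hy => setLIntegral_mono' hBm fun x hx => hpt y hy x hx
    _ = ∫⁻ y in B, ∫⁻ t in Set.Icc (0 : ℝ) 1, ∫⁻ x in B, g (AffineMap.lineMap y x t) := by
        refine lintegral_congr fun y => lintegral_lintegral_swap (Measurable.aemeasurable ?_)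
        exact hmeas.comp (f := fun p : EuclideanSpace ℝ (Fin n) × ℝ => ((y, p.2), p.1))
          (by fun_prop)
    _ = ∫⁻ t in Set.Icc (0 : ℝ) 1, ∫⁻ y in B, ∫⁻ x in B, g (AffineMap.lineMap y x t) :=
        lintegral_lintegral_swap (Measurable.aemeasurable hmeas.lintegral_prod_right')
    _ ≤ ∫⁻ t in Set.Icc (0 : ℝ) 1, 2 ^ n * (∫⁻ x in B, g x) * volume B :=
        setLIntegral_mono' measurableSet_Icc hslice
    _ = _ := by simp

end Poincare

section Growth

variable {n : ℕ} {lam : ℝ} {a : EuclideanSpace ℝ (Fin n) → Matrix (Fin n) (Fin n) ℝ}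
  {v : EuclideanSpace ℝ (Fin n) → ℝ}

/-- The logarithm of a positive solution has bounded energy. -/
lemma IsEllipticSolution.integral_cutoff_mul_gradient_log_le (h : IsEllipticSolution lam a v)
    (hlam : 0 < lam) (hpos : ∀ x ∈ ball 0 1, 0 < v x) :
    (Integrable fun x => ballCutoff (3 / 4) x ^ 2 * (v x ^ 2)⁻¹ * ‖gradient v x‖ ^ 2) ∧
    ∫ x, ballCutoff (3 / 4) x ^ 2 * (v x ^ 2)⁻¹ * ‖gradient v x‖ ^ 2 ≤
      4 / lam ^ 2 * (16 * volume.real (ball (0 : EuclideanSpace ℝ (Fin n)) (3 / 4))) := by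
  set η : EuclideanSpace ℝ (Fin n) → ℝ := ballCutoff (3 / 4) with hη
  have h34 : (0 : ℝ) ≤ 3 / 4 := by norm_num
  have hηc : ContDiff ℝ 1 η := contDiff_ballCutoff _
  have hηs : HasCompactSupport η := hasCompactSupport_ballCutoff h34
  have hηt : tsupport η ⊆ ball 0 1 :=
    (tsupport_ballCutoff_subset h34).trans (closedBall_subset_ball (by norm_num))
  have hvc := h.contDiff
  have hv0 : ∀ x ∈ tsupport η, v x ≠ 0 := fun x hx => (hpos x (hηt hx)).ne'
  have hgv := continuous_gradient hvc
  have hgη := continuous_gradient hηc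
  have i1 : Integrable fun x => η x ^ 2 * (v x ^ 2)⁻¹ * ‖gradient v x‖ ^ 2 := by
    refine Continuous.integrable_of_hasCompactSupport (continuous_iff_continuousAt.2 fun x => ?_)
      (HasCompactSupport.intro hηs fun x hx => by simp [image_eq_zero_of_notMem_tsupport hx])
    by_cases hx : x ∈ tsupport η
    · have := hv0 x hx
      exact ((hηc.continuous.continuousAt.pow 2).mul
        ((hvc.continuous.continuousAt.pow 2).inv₀ (pow_ne_zero 2 this))).mul
          (hgv.continuousAt.norm.pow 2)
    · refine (continuousAt_const (y := (0 : ℝ))).congr ?_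
      filter_upwards [notMem_tsupport_iff_eventuallyEq.1 hx] with y hy
      simp [hy]
  have i2 : Integrable fun x => (1 : ℝ) * ‖gradient η x‖ ^ 2 := by
    refine Continuous.integrable_of_hasCompactSupport (by fun_prop)
      (HasCompactSupport.intro hηs fun x hx => by simp [gradient_eq_zero_of_notMem_tsupport hx])
  have hinv : ∀ x ∈ tsupport η, HasDerivAt (fun t : ℝ => -t⁻¹) ((v x ^ 2)⁻¹) (v x) := by
    intro x hx
    rw [← neg_neg (v x ^ 2)⁻¹]
    exact (hasDerivAt_inv (hv0 x hx)).neg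
  have hφ : ContDiff ℝ 1 fun x => η x ^ 2 * -(v x)⁻¹ := by
    refine contDiff_iff_contDiffAt.2 fun x => ?_
    by_cases hx : x ∈ tsupport η
    · exact (hηc.contDiffAt.pow 2).mul (hvc.contDiffAt.inv (hv0 x hx)).neg
    · refine (contDiffAt_const (c := (0 : ℝ))).congr_of_eventuallyEq ?_
      filter_upwards [notMem_tsupport_iff_eventuallyEq.1 hx] with y hy
      simp [hy]
  have hcac := h.caccioppoli hlam (η := η) (F := fun x => -(v x)⁻¹) (F' := fun x => (v x ^ 2)⁻¹)
    (G := fun _ => 1) hηs hηt hφ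
    (fun x hx => by
      have hdv := hvc.differentiable one_ne_zero x
      rw [gradient_mul ((hηc.pow 2).differentiable one_ne_zero x)
        (g := fun x => -(v x)⁻¹) ((hdv.inv (hv0 x hx)).neg), gradient_comp (hinv x hx) hdv,
        gradient_comp (hasDerivAt_pow 2 (η x)) (hηc.differentiable one_ne_zero x), smul_smul,
        smul_smul]
      congr 2
      push_cast
      ring)
    (fun x _ => by positivity) (fun x _ => by positivity) (fun x _ => by simp) i1 i2
  refine ⟨i1, hcac.trans ?_⟩
  gcongr
  calc ∫ x, 1 * ‖gradient η x‖ ^ 2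
      ≤ ∫ x, (ball (0 : EuclideanSpace ℝ (Fin n)) (3 / 4)).indicator (fun _ => (16 : ℝ)) x := by
        refine integral_mono i2 ((integrableOn_const measure_ball_lt_top.ne).integrable_indicator
          measurableSet_ball) fun x => ?_
        simpa using norm_gradient_ballCutoff_le h34 (by norm_num) x
    _ = _ := by
        rw [integral_indicator measurableSet_ball]
        simp [mul_comm]

lemma IsEllipticSolution.lintegral_enorm_fderiv_log_le (n : ℕ) (hlam : 0 < lam) :
    ∃ C > (0 : ℝ), ∀ (a : EuclideanSpace ℝ (Fin n) → Matrix (Fin n) (Fin n) ℝ)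
      (v : EuclideanSpace ℝ (Fin n) → ℝ), IsEllipticSolution lam a v →
      (∀ x ∈ ball 0 1, 0 < v x) →
      ∫⁻ x in ball 0 (1 / 2), ‖fderiv ℝ (fun x => Real.log (v x)) x‖ₑ ≤ ENNReal.ofReal C := by
  set B := ball (0 : EuclideanSpace ℝ (Fin n)) (1 / 2) with hB
  have hB0 : 0 < volume.real B :=
    ENNReal.toReal_pos (measure_ball_pos _ _ (by norm_num)).ne' measure_ball_lt_top.ne
  refine ⟨volume.real B + 4096 * (4 / lam ^ 2 *
    (16 * volume.real (ball (0 : EuclideanSpace ℝ (Fin n)) (3 / 4)))), by positivity,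
    fun a v h hpos => ?_⟩
  obtain ⟨i1, h1⟩ := h.integral_cutoff_mul_gradient_log_le hlam hpos
  set f := fun x => ballCutoff (3 / 4) x ^ 2 * (v x ^ 2)⁻¹ * ‖gradient v x‖ ^ 2 with hf
  have hf0 : ∀ x, 0 ≤ f x := fun x => by positivity
  have i2 : IntegrableOn (fun x => 1 + 4096 * f x) B :=
    (integrableOn_const measure_ball_lt_top.ne).add (i1.integrableOn.const_mul _)
  have hpt : ∀ x ∈ B, ‖fderiv ℝ (fun x => Real.log (v x)) x‖ ≤ 1 + 4096 * f x := by
    intro x hx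
    have hvx : 0 < v x := hpos x (ball_subset_ball (by norm_num) hx)
    rw [((h.contDiff.differentiable one_ne_zero x).hasFDerivAt.log hvx.ne').fderiv, norm_smul,
      ← norm_gradient, norm_inv, Real.norm_of_nonneg hvx.le]
    have hη : 1 / 64 ≤ ballCutoff (3 / 4) x := by
      have := le_ballCutoff (ρ := 3 / 4) (by norm_num) (by norm_num) hx
      norm_num at this ⊢
      exact this
    have hη2 : 1 / 4096 ≤ ballCutoff (3 / 4) x ^ 2 := by nlinarith
    set t := (v x)⁻¹ * ‖gradient v x‖ with ht
    have hft : f x = ballCutoff (3 / 4) x ^ 2 * t ^ 2 := by simp only [hf, ht]; ring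
    rw [hft]
    nlinarith [mul_le_mul_of_nonneg_right hη2 (sq_nonneg t), sq_nonneg (t - 1)]
  calc ∫⁻ x in B, ‖fderiv ℝ (fun x => Real.log (v x)) x‖ₑ
      ≤ ∫⁻ x in B, ENNReal.ofReal (1 + 4096 * f x) := by
        refine setLIntegral_mono' measurableSet_ball fun x hx => ?_
        rw [← ofReal_norm]
        exact ENNReal.ofReal_le_ofReal (hpt x hx)
    _ = ENNReal.ofReal (∫ x in B, (1 + 4096 * f x)) :=
        (ofReal_integral_eq_lintegral_ofReal i2
          (Filter.Eventually.of_forall fun x => by have := hf0 x; positivity)).symm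
    _ ≤ _ := by
        refine ENNReal.ofReal_le_ofReal ?_
        have i3 : Integrable (fun _ : EuclideanSpace ℝ (Fin n) => (1 : ℝ)) (volume.restrict B) :=
          integrableOn_const measure_ball_lt_top.ne
        rw [integral_add i3 (i1.integrableOn.const_mul _), integral_const_mul]
        have h2 := setIntegral_le_integral (s := B) i1 (Filter.Eventually.of_forall hf0)
        simp only [integral_const, measureReal_restrict_apply_univ, smul_eq_mul, mul_one]
        linarith

/-- A positive solution that is large on half of a ball is rarely small there. -/
lemma IsEllipticSolution.measure_lt_mul_log_le (n : ℕ) (hlam : 0 < lam) :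
    ∃ C > (0 : ℝ), ∀ (a : EuclideanSpace ℝ (Fin n) → Matrix (Fin n) (Fin n) ℝ)
      (v : EuclideanSpace ℝ (Fin n) → ℝ), IsEllipticSolution lam a v →
      (∀ x ∈ ball 0 1, 0 < v x) →
      volume.real (ball (0 : EuclideanSpace ℝ (Fin n)) (1 / 2)) ≤
        2 * volume.real (ball 0 (1 / 2) ∩ {x | 1 ≤ v x}) →
      ∀ ε ∈ Set.Ioo (0 : ℝ) 1,
        volume.real (ball 0 (1 / 2) ∩ {x | v x < ε}) * -Real.log ε ≤ C := by
  obtain ⟨C, hC0, hC⟩ := IsEllipticSolution.lintegral_enorm_fderiv_log_le n hlam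
  refine ⟨2 ^ (n + 1) * C, by positivity, fun a v h hpos hE ε hε => ?_⟩
  set B := ball (0 : EuclideanSpace ℝ (Fin n)) (1 / 2) with hB
  have hB1 : B ⊆ ball 0 1 := ball_subset_ball (by norm_num)
  have hBf : volume B ≠ ⊤ := measure_ball_lt_top.ne
  have hB0 : 0 < volume.real B :=
    ENNReal.toReal_pos (measure_ball_pos _ _ (by norm_num)).ne' hBf
  set E := B ∩ {x | 1 ≤ v x} with hEdef
  set F := B ∩ {x | v x < ε} with hFdef
  have cv := h.contDiff.continuous
  have hEm : MeasurableSet E :=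
    measurableSet_ball.inter (isClosed_le continuous_const cv).measurableSet
  have hFm : MeasurableSet F :=
    measurableSet_ball.inter (isOpen_lt cv continuous_const).measurableSet
  have hEf : volume E ≠ ⊤ := measure_ne_top_of_subset Set.inter_subset_left hBf
  have hFf : volume F ≠ ⊤ := measure_ne_top_of_subset Set.inter_subset_left hBf
  have hlog : 0 ≤ -Real.log ε := by linarith [Real.log_neg hε.1 hε.2]
  have hw : ContDiffOn ℝ 1 (fun x => Real.log (v x)) B :=
    h.contDiff.contDiffOn.log fun x hx => (hpos x (hB1 hx)).ne'
  have h1 : ENNReal.ofReal (-Real.log ε) * volume E * volume F ≤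
      2 ^ n * ENNReal.ofReal C * volume B := by
    calc _ = ∫⁻ y in F, ∫⁻ x in E, ENNReal.ofReal (-Real.log ε) := by
          simp only [setLIntegral_const]
      _ ≤ ∫⁻ y in F, ∫⁻ x in E, ‖Real.log (v x) - Real.log (v y)‖ₑ := by
          refine setLIntegral_mono' hFm fun y hy => setLIntegral_mono' hEm fun x hx => ?_
          rw [← ofReal_norm]
          refine ENNReal.ofReal_le_ofReal ((le_abs_self _).trans' ?_)
          have h2 : 0 ≤ Real.log (v x) := Real.log_nonneg hx.2
          have h3 : Real.log (v y) ≤ Real.log ε :=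
            Real.log_le_log (hpos y (hB1 hy.1)) (le_of_lt hy.2)
          linarith
      _ ≤ ∫⁻ y in B, ∫⁻ x in B, ‖Real.log (v x) - Real.log (v y)‖ₑ :=
          (lintegral_mono fun y => lintegral_mono_set Set.inter_subset_left).trans
            (lintegral_mono_set Set.inter_subset_left)
      _ ≤ 2 ^ n * (∫⁻ x in B, ‖fderiv ℝ (fun x => Real.log (v x)) x‖ₑ) * volume B :=
          lintegral_lintegral_enorm_sub_le hw
      _ ≤ _ := by gcongr; exact hC a v h hpos
  have h2 : -Real.log ε * volume.real E * volume.real F ≤ 2 ^ n * C * volume.real B := by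
    have h3 := ENNReal.toReal_mono (by finiteness) h1
    simpa [ENNReal.toReal_mul, ENNReal.toReal_ofReal hlog, ENNReal.toReal_ofReal hC0.le,
      measureReal_def] using h3
  have hE0 : 0 < volume.real E := by linarith
  refine le_of_mul_le_mul_left ?_ hE0
  calc _ = -Real.log ε * volume.real E * volume.real F := by ring
    _ ≤ 2 ^ n * C * volume.real B := h2
    _ ≤ 2 ^ n * C * (2 * volume.real E) := by gcongr
    _ = _ := by ring

end Growth

section Holder

variable {n : ℕ} {lam : ℝ} {a : EuclideanSpace ℝ (Fin n) → Matrix (Fin n) (Fin n) ℝ}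
  {v : EuclideanSpace ℝ (Fin n) → ℝ}

/-- A nonnegative solution that is at least `1` on half of a ball is bounded below in a smaller
ball. -/
lemma IsEllipticSolution.le_of_measure_le (hn : 1 ≤ n) (hlam : 0 < lam) :
    ∃ θ ∈ Set.Ioo (0 : ℝ) 1, ∀ (a : EuclideanSpace ℝ (Fin n) → Matrix (Fin n) (Fin n) ℝ)
      (v : EuclideanSpace ℝ (Fin n) → ℝ), IsEllipticSolution lam a v →
      (∀ x ∈ ball 0 1, 0 ≤ v x) →
      volume.real (ball (0 : EuclideanSpace ℝ (Fin n)) (1 / 2)) ≤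
        2 * volume.real (ball 0 (1 / 2) ∩ {x | 1 ≤ v x}) →
      ∀ x ∈ ball 0 (1 / 4), θ ≤ v x := by
  obtain ⟨ν, hν0, hν⟩ := IsEllipticSolution.le_half_of_measure_pos_le hn hlam
  obtain ⟨C, hC0, hC⟩ := IsEllipticSolution.measure_lt_mul_log_le n hlam
  set ε := Real.exp (-(C / ν + 1)) with hε
  have hε0 : 0 < ε := Real.exp_pos _
  have hε1 : ε < 1 := (Real.exp_lt_exp.2 (by linarith [div_pos hC0 hν0])).trans_eq Real.exp_zero
  refine ⟨ε / 2, ⟨by linarith, by linarith⟩, fun a v h hv hE x hx => ?_⟩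
  refine le_of_forall_pos_le_add fun δ hδ => ?_
  have hEδ : volume.real (ball (0 : EuclideanSpace ℝ (Fin n)) (1 / 2)) ≤
      2 * volume.real (ball 0 (1 / 2) ∩ {x | 1 ≤ 1 * v x + δ}) := by
    refine hE.trans ?_
    gcongr
    · exact measure_ne_top_of_subset Set.inter_subset_left measure_ball_lt_top.ne
    · linarith
  have hF := hC a _ (h.affine 1 δ) (fun y hy => by linarith [hv y hy]) hEδ ε ⟨hε0, hε1⟩
  rw [hε, Real.log_exp, neg_neg, ← hε] at hF
  have hFν : volume.real (ball (0 : EuclideanSpace ℝ (Fin n)) (1 / 2) ∩ {x | 1 * v x + δ < ε}) ≤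
      ν := by
    have h1 : 0 < C / ν + 1 := by positivity
    refine le_of_mul_le_mul_right (hF.trans ?_) h1
    rw [mul_add, mul_div_cancel₀ _ hν0.ne']
    linarith
  have hset : {y | 0 < -ε⁻¹ * v y + (1 - δ / ε)} = {y | 1 * v y + δ < ε} := by
    ext y
    have : -ε⁻¹ * v y + (1 - δ / ε) = (ε - (v y + δ)) / ε := by field_simp; ring
    simp only [Set.mem_ofPred_eq, this, one_mul]
    rw [div_pos_iff_of_pos_right hε0, sub_pos]
  have hhalf := hν a _ (h.affine (-ε⁻¹) (1 - δ / ε)) (fun y hy => by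
    have h1 := hv y (ball_subset_ball (by norm_num) hy)
    have h2 : 0 ≤ ε⁻¹ * v y := by positivity
    have h3 : 0 ≤ δ / ε := by positivity
    linarith) (by rw [hset]; exact hFν) x hx
  have h4 : -ε⁻¹ * v x + (1 - δ / ε) = 1 - (v x + δ) / ε := by field_simp; ring
  rw [h4, sub_le_comm, le_div_iff₀ hε0] at hhalf
  linarith

lemma IsEllipticSolution.oscillation_decay (hn : 1 ≤ n) (hlam : 0 < lam) :
    ∃ γ ∈ Set.Ioo (1 / 2 : ℝ) 1,
      ∀ (a : EuclideanSpace ℝ (Fin n) → Matrix (Fin n) (Fin n) ℝ)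
        (v : EuclideanSpace ℝ (Fin n) → ℝ), IsEllipticSolution lam a v →
        ∀ m M, (∀ x ∈ ball 0 1, v x ∈ Set.Icc m M) →
        ∃ m' M', M' - m' = γ * (M - m) ∧ ∀ x ∈ ball 0 (1 / 4), v x ∈ Set.Icc m' M' := by
  obtain ⟨θ, ⟨hθ0, hθ1⟩, hθ⟩ := IsEllipticSolution.le_of_measure_le hn hlam
  refine ⟨1 - θ / 2, ⟨by linarith, by linarith⟩, fun a v h m M hv => ?_⟩
  have hsub : ball (0 : EuclideanSpace ℝ (Fin n)) (1 / 4) ⊆ ball 0 1 :=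
    ball_subset_ball (by norm_num)
  have hmM : m ≤ M := by
    have := hv 0 (mem_ball_self one_pos)
    exact this.1.trans this.2
  rcases hmM.eq_or_lt with rfl | hmM
  · exact ⟨m, m, by simp, fun x hx => hv x (hsub hx)⟩
  set d := (M - m) / 2 with hd
  have hd0 : 0 < d := by linarith [sub_pos.2 hmM]
  set B := ball (0 : EuclideanSpace ℝ (Fin n)) (1 / 2) with hB
  have hBf : volume B ≠ ⊤ := measure_ball_lt_top.ne
  have cv := h.contDiff.continuous
  have e1 : ∀ x, d⁻¹ * v x + -(m / d) = (v x - m) / d := fun x => by ring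
  have e2 : ∀ x, -d⁻¹ * v x + M / d = (M - v x) / d := fun x => by ring
  by_cases hE : volume.real B ≤ 2 * volume.real (B ∩ {x | 1 ≤ d⁻¹ * v x + -(m / d)})
  · refine ⟨m + θ * d, M, by rw [hd]; ring, fun x hx => ⟨?_, (hv x (hsub hx)).2⟩⟩
    have h1 := hθ a _ (h.affine d⁻¹ (-(m / d))) (fun y hy => by
      rw [e1]
      exact div_nonneg (by linarith [(hv y hy).1]) hd0.le) hE x hx
    rw [e1, le_div_iff₀ hd0] at h1
    linarith
  · refine ⟨m, M - θ * d, by rw [hd]; ring, fun x hx => ⟨(hv x (hsub hx)).1, ?_⟩⟩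
    have hE' : volume.real B ≤ 2 * volume.real (B ∩ {x | 1 ≤ -d⁻¹ * v x + M / d}) := by
      have hS : MeasurableSet {x | 1 ≤ d⁻¹ * v x + -(m / d)} :=
        (isClosed_le continuous_const (by fun_prop)).measurableSet
      have h1 := measureReal_inter_add_sdiff (s := B) hS hBf
      have h2 : volume.real (B \ {x | 1 ≤ d⁻¹ * v x + -(m / d)}) ≤
          volume.real (B ∩ {x | 1 ≤ -d⁻¹ * v x + M / d}) := by
        refine measureReal_mono (fun x hx => ⟨hx.1, ?_⟩)
          (measure_ne_top_of_subset Set.inter_subset_left hBf)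
        have h3 := hx.2
        simp only [Set.mem_ofPred_eq, e1, e2, not_le] at h3 ⊢
        rw [div_lt_one hd0] at h3
        rw [one_le_div hd0]
        linarith
      linarith
    have h1 := hθ a _ (h.affine (-d⁻¹) (M / d)) (fun y hy => by
      rw [e2]
      exact div_nonneg (by linarith [(hv y hy).2]) hd0.le) hE' x hx
    rw [e2, le_div_iff₀ hd0] at h1
    linarith

lemma IsEllipticSolution.oscillation_decay_pow (hn : 1 ≤ n) (hlam : 0 < lam) :
    ∃ γ ∈ Set.Ioo (1 / 2 : ℝ) 1, ∀ (j : ℕ)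
      (a : EuclideanSpace ℝ (Fin n) → Matrix (Fin n) (Fin n) ℝ)
        (v : EuclideanSpace ℝ (Fin n) → ℝ), IsEllipticSolution lam a v →
        ∀ m M, (∀ x ∈ ball 0 1, v x ∈ Set.Icc m M) →
        ∃ m' M', M' - m' = γ ^ j * (M - m) ∧ ∀ x ∈ ball 0 ((1 / 4) ^ j), v x ∈ Set.Icc m' M' := by
  obtain ⟨γ, hγ, H⟩ := IsEllipticSolution.oscillation_decay hn hlam
  refine ⟨γ, hγ, fun j => ?_⟩
  induction j with
  | zero => exact fun a v _ m M hv => ⟨m, M, by simp, by simpa using hv⟩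
  | succ j ih =>
    intro a v h m M hv
    obtain ⟨m₁, M₁, h1, hv1⟩ := H a v h m M hv
    obtain ⟨m₂, M₂, h2, hv2⟩ := ih _ _ (h.scale (r := 1 / 4) (by norm_num) (by norm_num)) m₁ M₁
      fun x hx => hv1 _ (by
        rw [mem_ball_zero_iff] at hx ⊢
        rw [norm_smul, Real.norm_of_nonneg (by norm_num)]
        linarith)
    refine ⟨m₂, M₂, by rw [h2, h1]; ring, fun x hx => ?_⟩
    have h3 := hv2 ((4 : ℝ) • x) (by
      rw [mem_ball_zero_iff, pow_succ] at hx
      rw [mem_ball_zero_iff, norm_smul, Real.norm_of_nonneg (by norm_num)]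
      linarith)
    rwa [smul_smul, one_div_mul_cancel (by norm_num), one_smul] at h3

/-- Hölder continuity at the centre of the unit ball. -/
lemma IsEllipticSolution.abs_sub_le (hn : 1 ≤ n) (hlam : 0 < lam) :
    ∃ α ∈ Set.Ioo (0 : ℝ) 1, ∀ (a : EuclideanSpace ℝ (Fin n) → Matrix (Fin n) (Fin n) ℝ)
        (v : EuclideanSpace ℝ (Fin n) → ℝ), IsEllipticSolution lam a v →
        ∀ M, (∀ x ∈ ball 0 1, |v x| ≤ M) →
        ∀ z ∈ ball 0 1, |v z - v 0| ≤ 2 * M * (16 * ‖z‖) ^ α := by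
  obtain ⟨γ, ⟨hγ0, hγ1⟩, H⟩ := IsEllipticSolution.oscillation_decay_pow hn hlam
  have hγ : 0 < γ := by linarith
  have hα : (1 / 4 : ℝ) ^ Real.logb (1 / 4) γ = γ :=
    Real.rpow_logb (by norm_num) (by norm_num) hγ
  have hα0 : 0 < Real.logb (1 / 4) γ :=
    Real.logb_pos_of_base_lt_one (by norm_num) (by norm_num) hγ hγ1
  refine ⟨Real.logb (1 / 4) γ, ⟨hα0, ?_⟩, ?_⟩
  · rw [Real.logb_lt_iff_lt_rpow_of_base_lt_one (by norm_num) (by norm_num) hγ, Real.rpow_one]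
    linarith
  intro a v h M hM z hz
  set α := Real.logb (1 / 4) γ
  have hM0 : 0 ≤ M := (abs_nonneg _).trans (hM 0 (mem_ball_self one_pos))
  rcases eq_or_ne z 0 with rfl | hz0
  · rw [sub_self, abs_zero]
    positivity
  rcases le_or_gt (4 * ‖z‖) 1 with h4 | h4
  · obtain ⟨j, hj1, hj2⟩ := exists_nat_pow_near_of_lt_one
      (show 0 < 4 * ‖z‖ by positivity) h4 (by norm_num : (0 : ℝ) < 1 / 4) (by norm_num)
    have hj : (0 : ℝ) < (1 / 4) ^ j := by positivity
    obtain ⟨m', M', h1, hv⟩ := H j a v h (-M) M fun x hx => abs_le.1 (hM x hx)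
    have hz' := hv z (by rw [mem_ball_zero_iff]; linarith)
    have h0' := hv 0 (mem_ball_self hj)
    have h2 : |v z - v 0| ≤ M' - m' := by
      rw [abs_le]
      constructor <;> linarith [hz'.1, hz'.2, h0'.1, h0'.2]
    calc |v z - v 0| ≤ 2 * M * γ ^ j := by rw [h1] at h2; linarith
      _ = 2 * M * ((1 / 4) ^ j) ^ α := by
        rw [← hα, ← Real.rpow_natCast, ← Real.rpow_natCast, ← Real.rpow_mul (by norm_num),
          ← Real.rpow_mul (by norm_num), mul_comm α]
      _ ≤ _ := by
        gcongr
        rw [pow_succ] at hj1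
        linarith
  · have h1 : 1 ≤ (16 * ‖z‖) ^ α := Real.one_le_rpow (by linarith) hα0.le
    calc |v z - v 0| ≤ |v z| + |v 0| := abs_sub _ _
      _ ≤ 2 * M * 1 := by linarith [hM z hz, hM 0 (mem_ball_self one_pos)]
      _ ≤ _ := by gcongr

/-- A function that is `C¹` in the unit ball agrees on each smaller ball with a globally `C¹`
function. -/
lemma exists_contDiff_eqOn_ball (hv : ContDiffOn ℝ 1 v (ball 0 1)) {s : ℝ} (hs0 : 0 < s)
    (hs1 : s < 1) :
    ∃ w : EuclideanSpace ℝ (Fin n) → ℝ, ContDiff ℝ 1 w ∧ Set.EqOn v w (ball 0 s) := by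
  let χ : ContDiffBump (0 : EuclideanSpace ℝ (Fin n)) := ⟨s, (s + 1) / 2, hs0, by linarith⟩
  refine ⟨fun x => χ x * v x, contDiff_iff_contDiffAt.2 fun x => ?_, fun x hx => ?_⟩
  · by_cases hx : x ∈ tsupport χ
    · rw [χ.tsupport_eq] at hx
      have hx1 : x ∈ ball 0 1 :=
        closedBall_subset_ball (show (s + 1) / 2 < 1 by linarith) hx
      exact χ.contDiffAt.mul (hv.contDiffAt (isOpen_ball.mem_nhds hx1))
    · refine (contDiffAt_const (c := (0 : ℝ))).congr_of_eventuallyEq ?_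
      filter_upwards [notMem_tsupport_iff_eventuallyEq.1 hx] with y hy
      simp [hy]
  · simp [χ.one_of_mem_closedBall (ball_subset_closedBall hx)]

end Holder

/-- De Giorgi–Nash interior Hölder estimate. -/
theorem deGiorgi_Nash_holder_estimate (n : ℕ) (hn : 1 ≤ n) (lam : ℝ)
    (hlam : lam ∈ Set.Ioc (0 : ℝ) 1) :
    ∃ α ∈ Set.Ioo (0 : ℝ) 1, ∃ C > (0 : ℝ),
      ∀ a : EuclideanSpace ℝ (Fin n) → Matrix (Fin n) (Fin n) ℝ,
        (∀ i j, Measurable fun x => a x i j) →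
        UniformlyElliptic lam (ball (0 : EuclideanSpace ℝ (Fin n)) 1) a →
        ∀ v : EuclideanSpace ℝ (Fin n) → ℝ,
          ContDiffOn ℝ 1 v (ball (0 : EuclideanSpace ℝ (Fin n)) 1) →
          BddAbove ((fun x => |v x|) '' ball (0 : EuclideanSpace ℝ (Fin n)) 1) →
          IsWeakSolution (ball (0 : EuclideanSpace ℝ (Fin n)) 1) a v →
          ∀ x ∈ ball (0 : EuclideanSpace ℝ (Fin n)) (1 / 2),
            ∀ y ∈ ball (0 : EuclideanSpace ℝ (Fin n)) (1 / 2),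
              |v x - v y| ≤
                C * sSup ((fun z => |v z|) '' ball (0 : EuclideanSpace ℝ (Fin n)) 1) *
                  dist x y ^ α := by
  obtain ⟨α, hα, H⟩ := IsEllipticSolution.abs_sub_le hn hlam.1
  refine ⟨α, hα, 2 * 32 ^ α, by positivity, fun a ham hae v hv hb h x hx y hy => ?_⟩
  set M := sSup ((fun z => |v z|) '' ball (0 : EuclideanSpace ℝ (Fin n)) 1)
  have hM : ∀ z ∈ ball 0 1, |v z| ≤ M := fun z hz => le_csSup hb ⟨z, hz, rfl⟩
  have hM0 : 0 ≤ M := (abs_nonneg _).trans (hM 0 (mem_ball_self one_pos))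
  rw [show 2 * 32 ^ α * M * dist x y ^ α = 2 * M * (32 * dist x y) ^ α by
    rw [Real.mul_rpow (by norm_num) dist_nonneg]; ring]
  rcases le_or_gt (1 / 2) (dist x y) with hd | hd
  · have h1 : 1 ≤ (32 * dist x y) ^ α := Real.one_le_rpow (by linarith) hα.1.le
    have hsub : ball (0 : EuclideanSpace ℝ (Fin n)) (1 / 2) ⊆ ball 0 1 :=
      ball_subset_ball (by norm_num)
    calc |v x - v y| ≤ |v x| + |v y| := abs_sub _ _
      _ ≤ 2 * M * 1 := by linarith [hM x (hsub hx), hM y (hsub hy)]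
      _ ≤ _ := by gcongr
  · rw [mem_ball_zero_iff] at hx
    obtain ⟨w, hwc, hvw⟩ := exists_contDiff_eqOn_ball hv (s := ‖x‖ + 1 / 2)
      (by positivity) (by linarith)
    have hsub : ball x (1 / 2) ⊆ ball 0 (‖x‖ + 1 / 2) :=
      ball_subset_ball' (by rw [dist_zero_right, add_comm])
    have hsub' : ball x (1 / 2) ⊆ ball 0 1 := hsub.trans (ball_subset_ball (by linarith))
    have hsol : IsEllipticSolution lam (fun z => a (x + (1 / 2 : ℝ) • z))
        (fun z => w (x + (1 / 2 : ℝ) • z)) :=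
      .of_affine (by norm_num) ham (fun z hz => hae z (hsub' hz)) hwc
        ((h.mono hsub').congr isOpen_ball (hvw.mono hsub))
    have hmem : ∀ z ∈ ball (0 : EuclideanSpace ℝ (Fin n)) 1,
        x + (1 / 2 : ℝ) • z ∈ ball x (1 / 2) := fun z hz => by
      rw [mem_ball_zero_iff] at hz
      rw [mem_ball_iff_norm, add_sub_cancel_left, norm_smul, Real.norm_of_nonneg (by norm_num)]
      linarith
    have hz : ‖(2 : ℝ) • (y - x)‖ = 2 * dist x y := by
      rw [norm_smul, Real.norm_of_nonneg (by norm_num), dist_comm, dist_eq_norm]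
    have h1 := H _ _ hsol M (fun z hz => by
      rw [← hvw (hsub (hmem z hz))]
      exact hM _ (hsub' (hmem z hz))) ((2 : ℝ) • (y - x)) (by
        rw [mem_ball_zero_iff, hz]
        linarith)
    rw [smul_smul, one_div_mul_cancel (by norm_num), one_smul, add_sub_cancel, smul_zero, add_zero,
      ← hvw (hsub (mem_ball_self (by norm_num))), ← hvw (hsub (mem_ball'.2 hd)), hz,
      abs_sub_comm] at h1
    convert h1 using 3
    ring
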